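/- Every point set of n ≥ 3 points in general position in the plane admits a convex partition with at most ⌈(10n−18)/7⌉ faces. -/

import Mathlib

open Set

attribute [local instance] Classical.propDecidable

abbrev Pt : Type := ℝ × ℝ

/-- cross(k,l,m) = (l-k) × (m-l), positive iff (k,l,m) is positively oriented. -/
def cross (k l m : Pt) : ℝ :=
  (l.1 - k.1) * (m.2 - l.2) - (l.2 - k.2) * (m.1 - l.1)

/-- No three distinct points of `P` are collinear. -/
def GenPos (P : Finset Pt) : Prop :=
  ∀ k ∈ P, ∀ l ∈ P, ∀ m ∈ P, k ≠ l → l ≠ m → k ≠ m → cross k l m ≠ 0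

/-- The points of `P` on the boundary of the convex hull (extreme points). -/
noncomputable def hullPts (P : Finset Pt) : Finset Pt :=
  P.filter (fun x => x ∈ Set.extremePoints ℝ (convexHull ℝ (P : Set Pt)))

/-- Union of all segments determined by pairs of points of `P`. -/
def arrUnion (P : Finset Pt) : Set Pt :=
  ⋃ a ∈ P, ⋃ b ∈ P, segment ℝ a b

/-- A bounded face of the arrangement of all segments determined by `P`:
a bounded connected component of the complement of the union of the segments. -/
def IsBoundedFace (P : Finset Pt) (F : Set Pt) : Prop :=
  (∃ x, x ∉ arrUnion P ∧ F = connectedComponentIn (arrUnion P)ᶜ x) ∧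
  Bornology.IsBounded F

/-- An empty convex polygon with vertex set `p ⊆ P`: at least 3 vertices, each vertex is
an extreme point of the hull of `p`, and no point of `P` lies in the interior. -/
def IsEmptyPolygon (P p : Finset Pt) : Prop :=
  p ⊆ P ∧ 3 ≤ p.card ∧
  (∀ v ∈ p, v ∈ Set.extremePoints ℝ (convexHull ℝ (p : Set Pt))) ∧
  ∀ x ∈ P, x ∉ interior (convexHull ℝ (p : Set Pt))

/-- `{a,b}` is an edge of the polygon with vertex set `p`: a segment between two
distinct vertices lying on the boundary of the polygon. -/
def IsEdgeOf (p : Finset Pt) (a b : Pt) : Prop :=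
  a ∈ p ∧ b ∈ p ∧ a ≠ b ∧
  segment ℝ a b ⊆ frontier (convexHull ℝ (p : Set Pt))

/-- A convex partition of `P`: a finite set of empty convex polygons with vertices in `P`,
pairwise interior-disjoint, whose union is the convex hull of `P`. -/
def IsConvexPartition (P : Finset Pt) (U : Finset (Finset Pt)) : Prop :=
  (∀ p ∈ U, IsEmptyPolygon P p) ∧
  (∀ p ∈ U, ∀ q ∈ U, p ≠ q →
    interior (convexHull ℝ (p : Set Pt)) ∩ interior (convexHull ℝ (q : Set Pt)) = ∅) ∧
  (⋃ p ∈ U, convexHull ℝ (p : Set Pt)) = convexHull ℝ (P : Set Pt)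

theorem cross_rot (a b c : Pt) : cross a b c = cross b c a := by simp only [cross]; ring
theorem cross_swap (a b c : Pt) : cross a b c = - cross c b a := by simp only [cross]; ring

theorem cross_comb (u v x y : Pt) (s t : ℝ) (h : s + t = 1) :
    cross u v (s • x + t • y) = s * cross u v x + t * cross u v y := by
  have : t = 1 - s := by linarith
  subst this
  simp only [cross, Prod.fst_add, Prod.snd_add, Prod.smul_fst, Prod.smul_snd, smul_eq_mul]; ring

theorem convex_half (u v : Pt) : Convex ℝ {z : Pt | 0 ≤ cross u v z} := by
  intro x hx y hy s t hs ht hst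
  simp only [mem_ofPred_eq] at *
  rw [cross_comb _ _ _ _ _ _ hst]; positivity

theorem hull_half {s : Set Pt} {u v : Pt} (h : ∀ x ∈ s, 0 ≤ cross u v x) :
    ∀ z ∈ convexHull ℝ s, 0 ≤ cross u v z :=
  fun _ hz => convexHull_min (t := {z : Pt | 0 ≤ cross u v z}) h (convex_half u v) hz

/-- strictly positive away from the base segment -/
theorem hull_pos_seg {s : Set Pt} {u v a b : Pt} (ha : cross u v a = 0) (hb : cross u v b = 0)
    (h : ∀ x ∈ s, x = a ∨ x = b ∨ 0 < cross u v x) :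
    ∀ z ∈ convexHull ℝ s, z ∈ segment ℝ a b ∨ 0 < cross u v z := by
  have h0 : ∀ z ∈ segment ℝ a b, cross u v z = 0 := by
    rintro z ⟨s, t, hs, ht, hst, rfl⟩
    rw [cross_comb _ _ _ _ _ _ hst, ha, hb]; ring
  have hc : Convex ℝ {z : Pt | z ∈ segment ℝ a b ∨ 0 < cross u v z} := by
    intro x hx y hy s t hs ht hst
    simp only [mem_ofPred_eq] at *
    rcases eq_or_lt_of_le hs with rfl | hs
    · have : t = 1 := by linarith
      subst this; simpa using hy
    rcases eq_or_lt_of_le ht with rfl | ht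
    · have : s = 1 := by linarith
      subst this; simpa using hx
    rcases hx with hx | hx <;> rcases hy with hy | hy
    · left; exact (convex_segment a b) hx hy hs.le ht.le hst
    · right; rw [cross_comb _ _ _ _ _ _ hst, h0 x hx]; simp; positivity
    · right; rw [cross_comb _ _ _ _ _ _ hst, h0 y hy]; simp; positivity
    · right; rw [cross_comb _ _ _ _ _ _ hst]; positivity
  intro z hz
  refine convexHull_min (t := {z : Pt | z ∈ segment ℝ a b ∨ 0 < cross u v z}) ?_ hc hz
  intro x hx
  rcases h x hx with rfl | rfl | h
  · left; exact left_mem_segment _ _ _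
  · left; exact right_mem_segment _ _ _
  · right; exact h

theorem seg_split {x y z w : Pt} (hz : z ∈ segment ℝ x y) (hw : w ∈ segment ℝ x y) :
    z ∈ segment ℝ x w ∨ z ∈ segment ℝ w y := by
  have hc : ∀ z, z ∈ segment ℝ x y → ∃ θ : ℝ, 0 ≤ θ ∧ θ ≤ 1 ∧ z = x + θ • (y - x) := by
    intro z hz
    rw [segment_eq_image'] at hz
    obtain ⟨θ, h, rfl⟩ := hz
    exact ⟨θ, h.1, h.2, rfl⟩
  obtain ⟨θ, h1, h2, rfl⟩ := hc z hz
  obtain ⟨ω, h3, h4, rfl⟩ := hc w hw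
  rcases le_total θ ω with h | h
  · left
    rw [segment_eq_image']
    rcases eq_or_lt_of_le h3 with rfl | h3
    · have : θ = 0 := le_antisymm h h1
      subst this; exact ⟨0, by simp, by simp⟩
    refine ⟨θ / ω, ⟨by positivity, by rw [div_le_one h3]; exact h⟩, ?_⟩
    simp only [add_sub_cancel_left, smul_smul]
    rw [div_mul_cancel₀ _ h3.ne']
  · right
    rw [segment_symm, segment_eq_image']
    rcases eq_or_lt_of_le h4 with rfl | h4
    · have : θ = 1 := le_antisymm h2 h
      subst this; exact ⟨0, by simp, by simp⟩
    have h5 : 0 < 1 - ω := by linarith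
    refine ⟨(1 - θ) / (1 - ω), ⟨div_nonneg (by linarith) h5.le, by rw [div_le_one h5]; linarith⟩, ?_⟩
    have : x + ω • (y - x) - y = (-(1 - ω)) • (y - x) := by module
    simp only [this, smul_smul]
    have : (1 - θ) / (1 - ω) * (-(1 - ω)) = -(1 - θ) := by field_simp
    rw [this]; module

/-- merge conditions -/
structure MC (p q : Finset Pt) (a b : Pt) : Prop where
  ap : a ∈ p
  bp : b ∈ p
  aq : a ∈ q
  bq : b ∈ q
  hp : ∀ x ∈ p, x = a ∨ x = b ∨ 0 < cross a b x
  hq : ∀ y ∈ q, y = a ∨ y = b ∨ 0 < cross b a y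
  hpq : ∀ x ∈ p, ∀ y ∈ q, x = a ∨ x = b ∨ y = a ∨ y = b ∨ (0 < cross x a y ∧ 0 < cross y b x)

theorem cross_aab (a b : Pt) : cross a a b = 0 := by simp only [cross]; ring
theorem cross_aba (a b : Pt) : cross a b a = 0 := by simp only [cross]; ring
theorem cross_abb (a b : Pt) : cross a b b = 0 := by simp only [cross]; ring

theorem MC.symm {p q a b} (h : MC p q a b) : MC q p b a :=
  ⟨h.bq, h.aq, h.bp, h.ap, fun y hy => by have := h.hq y hy; tauto,
   fun x hx => by have := h.hp x hx; tauto, fun y hy x hx => by have := h.hpq x hx y hy; tauto⟩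

/-- weak -/
theorem MC.weak {p q a b} (h : MC p q a b) {x y : Pt} (hx : x ∈ convexHull ℝ (p : Set Pt))
    (hy : y ∈ convexHull ℝ (q : Set Pt)) : 0 ≤ cross x a y := by
  have h1 : ∀ x ∈ p, 0 ≤ cross x a y := by
    intro x hx
    apply hull_half (s := (q : Set Pt)) _ y hy
    intro y hy
    rcases h.hp x hx with rfl | rfl | h1
    · rw [cross_aab]
    · rcases h.hq y hy with rfl | rfl | h2
      · rw [cross_abb]
      · rw [cross_aba]
      · exact h2.le
    · rcases h.hq y hy with rfl | rfl | h2
      · rw [cross_abb]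
      · rw [cross_rot]; exact h1.le
      · rcases h.hpq x hx y hy with rfl | rfl | rfl | rfl | h
        · rw [cross_aab]
        · exact h2.le
        · rw [cross_abb]
        · rw [cross_rot]; exact h1.le
        · exact h.1.le
  have : 0 ≤ cross a y x := by
    apply hull_half (s := (p : Set Pt)) _ x hx
    intro x hx
    rw [← cross_rot]; exact h1 x hx
  rw [cross_rot]; exact this

theorem MC.strict {p q a b} (h : MC p q a b) {x y : Pt} (hx : x ∈ convexHull ℝ (p : Set Pt))
    (hy : y ∈ convexHull ℝ (q : Set Pt)) (hxa : 0 < cross a b x) (hyb : 0 < cross b a y) :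
    0 < cross x a y := by
  have h1 : ∀ x ∈ p, x = a ∨ 0 < cross x a y := by
    intro x hx
    rcases h.hp x hx with rfl | rfl | h1
    · exact Or.inl rfl
    · exact Or.inr hyb
    right
    have := hull_pos_seg (s := (q : Set Pt)) (u := x) (v := a) (a := a) (b := a) (cross_abb _ _)
      (cross_abb _ _) ?_ y hy
    · rcases this with h2 | h2
      · rw [segment_same] at h2
        rw [mem_singleton_iff] at h2
        subst h2
        rw [cross_abb] at hyb; exact absurd hyb (lt_irrefl _)
      · exact h2
    intro y hy
    rcases h.hq y hy with rfl | rfl | h2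
    · exact Or.inl rfl
    · right; right; rw [cross_rot]; exact h1
    · rcases h.hpq x hx y hy with rfl | rfl | rfl | rfl | h
      · rw [cross_aba] at h1; exact absurd h1 (lt_irrefl _)
      · rw [cross_abb] at h1; exact absurd h1 (lt_irrefl _)
      · exact Or.inl rfl
      · right; right; rw [cross_rot]; exact h1
      · exact Or.inr (Or.inr h.1)
  have := hull_pos_seg (s := (p : Set Pt)) (u := a) (v := y) (a := a) (b := a) (cross_aba _ _)
      (cross_aba _ _) ?_ x hx
  · rcases this with h2 | h2
    · rw [segment_same] at h2
      rw [mem_singleton_iff] at h2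
      subst h2
      rw [cross_aba] at hxa; exact absurd hxa (lt_irrefl _)
    · rw [cross_rot]; exact h2
  intro x hx
  rcases h1 x hx with h | h
  · exact Or.inl h
  · right; right; rw [← cross_rot]; exact h

theorem MC.hull {p q a b} (h : MC p q a b) :
    convexHull ℝ ((p ∪ q : Finset Pt) : Set Pt) = convexHull ℝ (p : Set Pt) ∪ convexHull ℝ (q : Set Pt) := by
  have hab1 : segment ℝ a b ⊆ convexHull ℝ (p : Set Pt) := segment_subset_convexHull h.ap h.bp
  have hab2 : segment ℝ a b ⊆ convexHull ℝ (q : Set Pt) := segment_subset_convexHull h.aq h.bq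
  rw [Finset.coe_union]
  apply subset_antisymm
  · rw [convexHull_union ⟨a, h.ap⟩ ⟨a, h.aq⟩]
    intro z hz
    rw [mem_convexJoin] at hz
    obtain ⟨x, hx, y, hy, hz⟩ := hz
    have c1 := hull_pos_seg (u := a) (v := b) (cross_aba a b) (cross_abb a b) h.hp x hx
    have c2 := hull_pos_seg (u := b) (v := a) (cross_abb b a) (cross_aba b a) h.hq y hy
    rcases c1 with c1 | c1
    · right; exact (convex_convexHull ℝ _).segment_subset (hab2 c1) hy hz
    rcases c2 with c2 | c2
    · left; exact (convex_convexHull ℝ _).segment_subset hx (hab1 c2) hz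
    have c3 := h.weak hx hy
    have c4 := h.symm.weak hy hx
    have e : cross a b x + cross b a y = cross x a y + cross y b x := by simp only [cross]; ring
    set α := cross a b x
    set β := cross b a y
    set γ := cross x a y
    set δ := cross y b x
    have hS : 0 < α + β := by linarith
    have key : β • x + α • y = δ • a + γ • b := by
      ext
      · simp only [Prod.fst_add, Prod.smul_fst, smul_eq_mul, α, β, γ, δ, cross]; ring
      · simp only [Prod.snd_add, Prod.smul_snd, smul_eq_mul, α, β, γ, δ, cross]; ring
    have w1 : (β / (α + β)) • x + (α / (α + β)) • y ∈ segment ℝ x y :=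
      ⟨_, _, by positivity, by positivity, by field_simp; ring, rfl⟩
    have w2 : (β / (α + β)) • x + (α / (α + β)) • y ∈ segment ℝ a b := by
      refine ⟨δ / (α + β), γ / (α + β), by positivity, by positivity, by rw [e]; field_simp; rw [e] at hS; rw [add_comm]; exact div_self hS.ne', ?_⟩
      have : ∀ (s t : ℝ) (x y : Pt), (s / (α + β)) • x + (t / (α + β)) • y = (1 / (α+β)) • (s • x + t • y) := by
        intro s t x y
        rw [smul_add, smul_smul, smul_smul]; congr 2 <;> ring
      rw [this, this, key]
    rcases seg_split hz w1 with hz | hz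
    · left; exact (convex_convexHull ℝ _).segment_subset hx (hab1 w2) hz
    · right; exact (convex_convexHull ℝ _).segment_subset (hab2 w2) hy hz
  · exact union_subset (convexHull_mono subset_union_left) (convexHull_mono subset_union_right)


/-- hull of a finite set -/
abbrev HH (f : Finset Pt) : Set Pt := convexHull ℝ (f : Set Pt)

theorem MC.ext1 {p q a b} (h : MC p q a b) {v : Pt} (hv : v ∈ Set.extremePoints ℝ (HH p))
    (hv0 : 0 < cross a b v) : v ∈ Set.extremePoints ℝ (HH (p ∪ q)) := by
  have hB : ∀ z ∈ HH q, 0 ≤ cross b a z := by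
    apply hull_half
    intro y hy
    rcases h.hq y hy with rfl | rfl | h2
    · rw [cross_abb]
    · rw [cross_aba]
    · exact h2.le
  rw [mem_extremePoints_iff_left] at hv ⊢
  have hsub : HH p ⊆ HH (p ∪ q) := by rw [HH, HH, h.hull]; exact subset_union_left
  refine ⟨hsub hv.1, ?_⟩
  intro y hy z hz hvyz
  have hab : ∀ z, cross b a z = - cross a b z := by intro z; simp only [cross]; ring
  set β := cross a b y with hβ
  set γ := cross a b z with hγ
  set α := cross a b v with hα
  have hS : 0 < α + |β| + |γ| + 1 := by positivity
  set S := α + |β| + |γ| + 1 with hSd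
  set e := α / S with he
  have he0 : 0 < e := by positivity
  have he1 : e < 1 := by rw [he, div_lt_one hS]; have := abs_nonneg β; have := abs_nonneg γ; linarith
  have key : ∀ x ∈ HH (p ∪ q), |cross a b x| ≤ |β| + |γ| → (1 - e) • v + e • x ∈ HH p := by
    intro x hx hle
    have hm : (1 - e) • v + e • x ∈ HH (p ∪ q) :=
      (convex_convexHull ℝ _) (hsub hv.1) hx (by linarith) he0.le (by ring)
    have hc : 0 < cross a b ((1 - e) • v + e • x) := by
      rw [cross_comb _ _ _ _ _ _ (by ring)]
      have h1 : 1 - e = (|β| + |γ| + 1) / S := by rw [he]; field_simp; rw [hSd]; ring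
      rw [h1, he]
      have h2 : (|β| + |γ| + 1) / S * cross a b v + α / S * cross a b x
        = α * (|β| + |γ| + 1 + cross a b x) / S := by rw [← hα]; field_simp
      rw [h2]
      have := neg_abs_le (cross a b x)
      have : 0 < |β| + |γ| + 1 + cross a b x := by linarith
      positivity
    rw [HH, h.hull] at hm
    rcases hm with hm | hm
    · exact hm
    · have := hB _ hm
      rw [hab] at this; linarith
  have hy' := key y hy (by have := abs_nonneg γ; rw [← hβ]; linarith)
  have hz' := key z hz (by have := abs_nonneg β; rw [← hγ]; linarith)
  have := hv.2 _ hy' _ hz' ?_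
  · have h3 : e • (y - v) = 0 := by
      have : (1 - e) • v + e • y - v = e • (y - v) := by module
      rw [← this, sub_eq_zero]; assumption
    rw [smul_eq_zero] at h3
    rcases h3 with h3 | h3
    · linarith
    · exact sub_eq_zero.1 h3
  · obtain ⟨s, t, hs, ht, hst, hh⟩ := hvyz
    refine ⟨s, t, hs, ht, hst, ?_⟩
    have : s • ((1 - e) • v + e • y) + t • ((1 - e) • v + e • z) = ((s+t) * (1 - e)) • v + e • (s • y + t • z) := by module
    rw [this, hh, hst]; module

theorem MC.ext2 {p q a b} (h : MC p q a b) (hv : a ∈ Set.extremePoints ℝ (HH p)) :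
    a ∈ Set.extremePoints ℝ (HH (p ∪ q)) := by
  rw [mem_extremePoints_iff_left] at hv ⊢
  have hsub : HH p ⊆ HH (p ∪ q) := by rw [HH, HH, h.hull]; exact subset_union_left
  refine ⟨hsub hv.1, ?_⟩
  intro y hy z hz hvyz
  have hab : ∀ z, cross b a z = - cross a b z := by intro z; simp only [cross]; ring
  rw [HH, h.hull] at hy hz
  have hab1 : segment ℝ a b ⊆ HH p := segment_subset_convexHull h.ap h.bp
  have c1 := hull_pos_seg (u := a) (v := b) (cross_aba a b) (cross_abb a b) h.hp
  have c2 := hull_pos_seg (u := b) (v := a) (cross_abb b a) (cross_aba b a) h.hq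
  have h0 : ∀ z ∈ segment ℝ a b, cross a b z = 0 := by
    rintro z ⟨s, t, hs, ht, hst, rfl⟩
    rw [cross_comb _ _ _ _ _ _ hst, cross_aba, cross_abb]; ring
  have cc : ∀ w ∈ HH p ∪ HH q, (w ∈ segment ℝ a b) ∨ (w ∈ HH p ∧ 0 < cross a b w) ∨ (w ∈ HH q ∧ 0 < cross b a w) := by
    intro w hw
    rcases hw with hw | hw
    · have := c1 w hw; tauto
    · have := c2 w hw; tauto
  have hcopy := hvyz
  obtain ⟨s, t, hs, ht, hst, hh⟩ := hvyz
  have e0 : s * cross a b y + t * cross a b z = 0 := by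
    rw [← cross_comb _ _ _ _ _ _ hst, hh, cross_aba]
  have e1 : cross y a z = 0 := by
    rw [← hh]
    have : t = 1 - s := by linarith
    subst this
    simp only [cross, Prod.fst_add, Prod.snd_add, Prod.smul_fst, Prod.smul_snd, smul_eq_mul]; ring
  have e2 : cross z a y = 0 := by rw [cross_swap, e1]; simp
  rcases cc y hy with k1 | ⟨k1, k1'⟩ | ⟨k1, k1'⟩ <;> rcases cc z hz with k2 | ⟨k2, k2'⟩ | ⟨k2, k2'⟩
  · exact hv.2 _ (hab1 k1) _ (hab1 k2) hcopy
  · rw [h0 _ k1] at e0; have := mul_pos ht k2'; linarith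
  · rw [hab] at k2'; rw [h0 _ k1] at e0; have := mul_pos ht k2'; linarith
  · rw [h0 _ k2] at e0; have := mul_pos hs k1'; linarith
  · have := mul_pos hs k1'; have := mul_pos ht k2'; linarith
  · have := h.strict k1 k2 k1' k2'; linarith
  · rw [hab] at k1'; rw [h0 _ k2] at e0; have := mul_pos hs k1'; linarith
  · have := h.strict k2 k1 k2' k1'; linarith
  · rw [hab] at k1' k2'; have := mul_pos hs k1'; have := mul_pos ht k2'; linarith

theorem MC.ext {p q a b} (h : MC p q a b) (hp : ∀ v ∈ p, v ∈ Set.extremePoints ℝ (HH p))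
    (hq : ∀ v ∈ q, v ∈ Set.extremePoints ℝ (HH q)) :
    ∀ v ∈ p ∪ q, v ∈ Set.extremePoints ℝ (HH (p ∪ q)) := by
  intro v hv
  have ha := h.ext2 (hp a h.ap)
  have hb : b ∈ Set.extremePoints ℝ (HH (p ∪ q)) := by
    rw [Finset.union_comm]; exact h.symm.ext2 (hq b h.bq)
  rcases Finset.mem_union.1 hv with hv | hv
  · rcases h.hp v hv with rfl | rfl | h1
    · exact ha
    · exact hb
    · exact h.ext1 (hp v hv) h1
  · rcases h.hq v hv with rfl | rfl | h1
    · exact ha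
    · exact hb
    · rw [Finset.union_comm]; exact h.symm.ext1 (hq v hv) h1

/-- triangles -/
noncomputable def TT (a b c : Pt) : Finset Pt := {a, b, c}

theorem mem_TT {a b c x : Pt} : x ∈ TT a b c ↔ x = a ∨ x = b ∨ x = c := by simp [TT]

theorem TT_rot (a b c : Pt) : TT a b c = TT b c a := by ext x; simp only [mem_TT]; tauto

theorem tri_key (a b c z : Pt) :
    cross a b c • z = cross b c z • a + cross c a z • b + cross a b z • c := by
  ext
  · simp only [Prod.fst_add, Prod.smul_fst, smul_eq_mul, cross]; ring
  · simp only [Prod.snd_add, Prod.smul_snd, smul_eq_mul, cross]; ring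

theorem tri_sum (a b c z : Pt) :
    cross a b c = cross b c z + cross c a z + cross a b z := by
  simp only [cross]; ring

theorem mem_tri {a b c : Pt} (h : 0 < cross a b c) {z : Pt} :
    z ∈ HH (TT a b c) ↔ 0 ≤ cross a b z ∧ 0 ≤ cross b c z ∧ 0 ≤ cross c a z := by
  have h1 : 0 < cross b c a := by rw [← cross_rot]; exact h
  have h2 : 0 < cross c a b := by rw [← cross_rot]; exact h1
  constructor
  · intro hz
    refine ⟨hull_half ?_ z hz, hull_half ?_ z hz, hull_half ?_ z hz⟩
    all_goals
      intro x hx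
      rcases mem_TT.1 (Finset.mem_coe.1 hx) with rfl | rfl | rfl
      all_goals first | (rw [cross_aba]) | (rw [cross_abb]) | (apply le_of_lt; assumption)
  · rintro ⟨z1, z2, z3⟩
    have hs := tri_sum a b c z
    have hk := tri_key a b c z
    have hK : Convex ℝ (HH (TT a b c)) := convex_convexHull ℝ _
    have ma : ∀ x ∈ TT a b c, x ∈ HH (TT a b c) := fun x hx => subset_convexHull ℝ _ hx
    set D := cross a b c
    have := hK.sum_mem (t := Finset.univ) (w := ![cross b c z / D, cross c a z / D, cross a b z / D])
      (z := ![a, b, c]) ?_ ?_ ?_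
    · simp only [Fin.sum_univ_three, Matrix.cons_val_zero, Matrix.cons_val_one, Matrix.cons_val] at this
      convert this using 1
      apply smul_right_injective Pt h.ne'
      change D • z = D • _
      rw [hk, smul_add, smul_add, smul_smul, smul_smul, smul_smul, mul_div_cancel₀ _ h.ne',
        mul_div_cancel₀ _ h.ne', mul_div_cancel₀ _ h.ne']
    · intro i _; fin_cases i <;> simp <;> positivity
    · simp only [Fin.sum_univ_three, Matrix.cons_val_zero, Matrix.cons_val_one, Matrix.cons_val]
      rw [← add_div, ← add_div, ← hs, div_self h.ne']
    · intro i _; fin_cases i <;> simp <;> apply ma <;> simp [TT]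

theorem cross_cont (u v : Pt) : Continuous (fun z => cross u v z) := by
  unfold cross; fun_prop

theorem tri_int {a b c : Pt} (h : 0 < cross a b c) : (interior (HH (TT a b c))).Nonempty := by
  have h1 : 0 < cross b c a := by rw [← cross_rot]; exact h
  have h2 : 0 < cross c a b := by rw [← cross_rot]; exact h1
  refine ⟨(1/3:ℝ) • a + (2/3:ℝ) • ((1/2:ℝ) • b + (1/2:ℝ) • c), ?_⟩
  apply interior_maximal (t := {z | 0 < cross a b z} ∩ ({z | 0 < cross b c z} ∩ {z | 0 < cross c a z}))
  · rintro z ⟨z1, z2, z3⟩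
    exact (mem_tri h).2 ⟨le_of_lt z1, le_of_lt z2, le_of_lt z3⟩
  · refine (isOpen_lt continuous_const (cross_cont _ _)).inter
      ((isOpen_lt continuous_const (cross_cont _ _)).inter (isOpen_lt continuous_const (cross_cont _ _)))
  · refine ⟨?_, ?_, ?_⟩
    all_goals
      change 0 < cross _ _ _
      rw [cross_comb _ _ _ _ _ _ (by norm_num), cross_comb _ _ _ _ _ _ (by norm_num)]
      simp only [cross_aba, cross_abb]
      linarith

theorem tri_ext1 {a b c : Pt} (h : 0 < cross a b c) : a ∈ Set.extremePoints ℝ (HH (TT a b c)) := by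
  rw [mem_extremePoints_iff_left]
  refine ⟨subset_convexHull ℝ _ (by simp [TT]), ?_⟩
  rintro y hy z hz ⟨s, t, hs, ht, hst, hh⟩
  rw [mem_tri h] at hy hz
  have e0 : s * cross a b y + t * cross a b z = 0 := by
    rw [← cross_comb _ _ _ _ _ _ hst, hh, cross_aba]
  have e1 : s * cross c a y + t * cross c a z = 0 := by
    rw [← cross_comb _ _ _ _ _ _ hst, hh, cross_abb]
  have f0 : cross a b y = 0 := by nlinarith [mul_nonneg hs.le hy.1, mul_nonneg ht.le hz.1]
  have f1 : cross c a y = 0 := by nlinarith [mul_nonneg hs.le hy.2.2, mul_nonneg ht.le hz.2.2]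
  have k := tri_key a b c y
  have k2 := tri_sum a b c y
  rw [f0, f1] at k k2
  rw [show cross b c y = cross a b c by linarith] at k
  simp only [zero_smul, add_zero] at k
  exact smul_right_injective Pt h.ne' k

theorem tri_ext {a b c : Pt} (h : 0 < cross a b c) :
    ∀ v ∈ TT a b c, v ∈ Set.extremePoints ℝ (HH (TT a b c)) := by
  have h1 : 0 < cross b c a := by rw [← cross_rot]; exact h
  have h2 : 0 < cross c a b := by rw [← cross_rot]; exact h1
  intro v hv
  rcases mem_TT.1 hv with rfl | rfl | rfl
  · exact tri_ext1 h
  · rw [TT_rot]; exact tri_ext1 h1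
  · rw [TT_rot, TT_rot]; exact tri_ext1 h2

theorem tri_card {a b c : Pt} (h : 0 < cross a b c) : 3 ≤ (TT a b c).card := by
  have h1 : a ≠ b := by rintro rfl; rw [cross_aab] at h; exact lt_irrefl _ h
  have h2 : a ≠ c := by rintro rfl; rw [cross_aba] at h; exact lt_irrefl _ h
  have h3 : b ≠ c := by rintro rfl; rw [cross_abb] at h; exact lt_irrefl _ h
  rw [TT, Finset.card_eq_three.2 ⟨a, b, c, h1, h2, h3, rfl⟩]

/-- separation -/
theorem int_pos {S : Set Pt} {u v z : Pt} (huv : u ≠ v) (hS : ∀ x ∈ S, 0 ≤ cross u v x)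
    (hz : z ∈ interior S) : 0 < cross u v z := by
  rcases lt_or_eq_of_le (hS z (interior_subset hz)) with h | h
  · exact h
  exfalso
  let n : Pt := (-(v.2 - u.2), v.1 - u.1)
  have hc : Continuous (fun e : ℝ => z - e • n) := by fun_prop
  have h0 : (fun e : ℝ => z - e • n) ⁻¹' (interior S) ∈ nhds (0:ℝ) := by
    apply hc.continuousAt.preimage_mem_nhds
    simp only [zero_smul, sub_zero]
    exact isOpen_interior.mem_nhds hz
  rw [Metric.mem_nhds_iff] at h0
  obtain ⟨ε, hε, hb⟩ := h0
  have hm : (ε/2) ∈ Metric.ball (0:ℝ) ε := by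
    rw [Metric.mem_ball, Real.dist_eq, sub_zero, abs_of_pos (by positivity)]; linarith
  have := hS _ (interior_subset (hb hm))
  have e : cross u v (z - (ε/2) • n) = cross u v z - (ε/2) * ((v.1-u.1)^2 + (v.2-u.2)^2) := by
    simp only [cross, n, Prod.fst_sub, Prod.snd_sub, Prod.smul_fst, Prod.smul_snd, smul_eq_mul]; ring
  rw [e, ← h] at this
  have hpos : 0 < (v.1-u.1)^2 + (v.2-u.2)^2 := by
    by_contra hcon
    apply huv
    have a1 : v.1 - u.1 = 0 := by nlinarith [sq_nonneg (v.1-u.1), sq_nonneg (v.2-u.2)]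
    have a2 : v.2 - u.2 = 0 := by nlinarith [sq_nonneg (v.1-u.1), sq_nonneg (v.2-u.2)]
    ext <;> linarith
  nlinarith


/-- the star region -/
def Reg (O : Pt) : List Pt → Set Pt
  | b :: a :: Z => HH (TT O a b) ∪ Reg O (a :: Z)
  | _ => ∅

theorem reg_cons (O b a : Pt) (Z : List Pt) : Reg O (b :: a :: Z) = HH (TT O a b) ∪ Reg O (a :: Z) := by
  rw [Reg]

theorem reg_one (O b : Pt) : Reg O [b] = ∅ := by simp [Reg]

theorem reg_append (O c : Pt) (Z : List Pt) : ∀ Y : List Pt,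
    Reg O (Y ++ c :: Z) = Reg O (Y ++ [c]) ∪ Reg O (c :: Z)
  | [] => by simp [reg_one]
  | [y] => by simp [reg_cons, reg_one]
  | y :: y' :: Y => by
    have := reg_append O c Z (y' :: Y)
    simp only [List.cons_append, reg_cons] at this ⊢
    rw [this, union_assoc]

/-- sorted -/
def Srt (O : Pt) (C : List Pt) : Prop := C.Pairwise (fun x y => 0 < cross O y x)

theorem c_neg (O x y : Pt) : cross O x y = - cross O y x := by simp only [cross]; ring

theorem hull3 {u v a b c : Pt} (ha : 0 ≤ cross u v a) (hb : 0 ≤ cross u v b) (hc : 0 ≤ cross u v c) :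
    ∀ z ∈ HH (TT a b c), 0 ≤ cross u v z := by
  apply hull_half
  intro x hx
  rcases mem_TT.1 (Finset.mem_coe.1 hx) with rfl | rfl | rfl <;> assumption

theorem reg_below {O c : Pt} : ∀ {Z : List Pt}, Srt O (c :: Z) → ∀ z ∈ Reg O (c :: Z), 0 ≤ cross c O z := by
  intro Z
  induction Z generalizing c with
  | nil => intro _ z hz; simp [reg_one] at hz
  | cons a Z ih =>
    intro h z hz
    rw [Srt, List.pairwise_cons] at h
    have hca := h.1 a (by simp)
    rw [reg_cons] at hz
    rcases hz with hz | hz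
    · refine hull3 ?_ ?_ ?_ z hz
      · rw [cross_abb]
      · rw [cross_rot]; exact hca.le
      · rw [cross_aba]
    · -- z in a wedge below a
      have key : ∀ (Z' : List Pt) (a : Pt), Srt O (a :: Z') → 0 < cross O a c → (∀ x ∈ Z', 0 < cross O x c) →
          ∀ z ∈ Reg O (a :: Z'), 0 ≤ cross c O z := by
        intro Z'
        induction Z' with
        | nil => intro a _ _ _ z hz; simp [reg_one] at hz
        | cons a' Z' ih =>
          intro a h1 h2 h3 z hz
          rw [reg_cons] at hz
          have h3' := h3 a' (by simp)
          rcases hz with hz | hz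
          · refine hull3 ?_ ?_ ?_ z hz
            · rw [cross_abb]
            · rw [cross_rot]; exact h3'.le
            · rw [cross_rot]; exact h2.le
          · exact ih a' (List.pairwise_cons.1 h1).2 h3' (fun x hx => h3 x (by simp [hx])) z hz
      exact key Z a h.2 hca (fun x hx => h.1 x (by simp [hx])) z hz

theorem reg_above {O c : Pt} : ∀ {Y : List Pt}, Srt O (Y ++ [c]) → ∀ z ∈ Reg O (Y ++ [c]), 0 ≤ cross O c z
  | [], _, z, hz => by simp [reg_one] at hz
  | [y], h, z, hz => by
    simp only [List.cons_append, List.nil_append, reg_cons, reg_one, union_empty] at hz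
    simp only [Srt, List.cons_append, List.nil_append, List.pairwise_cons] at h
    have hyc := h.1 c (by simp)
    refine hull3 ?_ ?_ ?_ z hz
    · rw [cross_aba]
    · rw [cross_abb]
    · exact hyc.le
  | y :: y' :: Y, h, z, hz => by
    simp only [List.cons_append, reg_cons] at hz
    simp only [Srt, List.cons_append] at h
    rw [List.pairwise_cons] at h
    have hyc := h.1 c (by simp)
    have hyc' := (List.pairwise_cons.1 h.2).1 c (by simp)
    rcases hz with hz | hz
    · refine hull3 ?_ ?_ ?_ z hz
      · rw [cross_aba]
      · exact hyc'.le
      · exact hyc.le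
    · exact reg_above (Y := y' :: Y) h.2 z hz

structure Face (P f : Finset Pt) : Prop where
  sub : f ⊆ P
  card : 3 ≤ f.card
  ext : ∀ v ∈ f, v ∈ Set.extremePoints ℝ (HH f)
  int : (interior (HH f)).Nonempty

theorem face_tri {P : Finset Pt} {a b c : Pt} (h : 0 < cross a b c) (ha : a ∈ P) (hb : b ∈ P) (hc : c ∈ P) :
    Face P (TT a b c) := by
  refine ⟨?_, tri_card h, tri_ext h, tri_int h⟩
  intro x hx
  rcases mem_TT.1 hx with rfl | rfl | rfl <;> assumption

structure SPart (O : Pt) (P : Finset Pt) (C : List Pt) (L : List (Finset Pt)) : Prop where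
  srt : Srt O C
  sub : ∀ x ∈ C, x ∈ P
  face : ∀ f ∈ L, Face P f
  disj : L.Pairwise (fun f g => Disjoint (interior (HH f)) (interior (HH g)))
  cov : ∀ z, (∃ f ∈ L, z ∈ HH f) ↔ z ∈ Reg O C

theorem SPart.perm {O P C L L'} (h : SPart O P C L) (hp : L.Perm L') : SPart O P C L' := by
  refine ⟨h.srt, h.sub, fun f hf => h.face f (hp.mem_iff.2 hf), ?_, ?_⟩
  · exact (hp.pairwise_iff (fun h => h.symm)).1 h.disj
  · intro z; rw [← h.cov z]
    constructor
    · rintro ⟨f, hf, hz⟩; exact ⟨f, hp.mem_iff.2 hf, hz⟩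
    · rintro ⟨f, hf, hz⟩; exact ⟨f, hp.mem_iff.1 hf, hz⟩

theorem SPart.add {O P C L C' f} (h : SPart O P C L) (hf : Face P f) (hs : Srt O C') (hsub : ∀ x ∈ C', x ∈ P)
    (hr : Reg O C' = HH f ∪ Reg O C) (hd : ∀ z ∈ interior (HH f), z ∉ Reg O C) :
    SPart O P C' (f :: L) := by
  refine ⟨hs, hsub, ?_, ?_, ?_⟩
  · intro g hg
    rcases List.mem_cons.1 hg with rfl | hg
    · exact hf
    · exact h.face g hg
  · rw [List.pairwise_cons]
    refine ⟨?_, h.disj⟩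
    intro g hg
    rw [Set.disjoint_left]
    intro z hz hz'
    exact hd z hz ((h.cov z).1 ⟨g, hg, interior_subset hz'⟩)
  · intro z
    rw [hr, mem_union, ← h.cov z]
    simp

theorem ne_of_cross {a b c : Pt} (h : 0 < cross a b c) : a ≠ b ∧ b ≠ c ∧ c ≠ a := by
  refine ⟨?_, ?_, ?_⟩
  · rintro rfl; rw [cross_aab] at h; exact lt_irrefl _ h
  · rintro rfl; rw [cross_abb] at h; exact lt_irrefl _ h
  · rintro rfl; rw [cross_aba] at h; exact lt_irrefl _ h

theorem cross_tr {O a b c : Pt} (P : Finset Pt) (hO : ∀ x ∈ P, ∀ y ∈ P, ∀ z ∈ P, 0 < cross O x y → 0 < cross O y z → 0 < cross O x z)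
    (ha : a ∈ P) (hb : b ∈ P) (hc : c ∈ P) (h1 : 0 < cross O a b) (h2 : 0 < cross O b c) : 0 < cross O a c :=
  hO a ha b hb c hc h1 h2

/-- transitivity of the angular order -/
def AngTr (O : Pt) (P : Finset Pt) : Prop :=
  ∀ x ∈ P, ∀ y ∈ P, ∀ z ∈ P, 0 < cross O x y → 0 < cross O y z → 0 < cross O x z

theorem SPart.append {O P a Z L b} (hT : AngTr O P) (hO : O ∈ P) (h : SPart O P (a :: Z) L) (hb : b ∈ P)
    (hab : 0 < cross O a b) : SPart O P (b :: a :: Z) (TT O a b :: L) := by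
  have ha : a ∈ P := h.sub a (by simp)
  refine h.add (face_tri hab hO ha hb) ?_ ?_ (reg_cons _ _ _ _) ?_
  · rw [Srt, List.pairwise_cons]
    refine ⟨?_, h.srt⟩
    intro x hx
    rcases List.mem_cons.1 hx with rfl | hx
    · exact hab
    · exact hT x (h.sub x (by simp [hx])) a ha b hb ((List.pairwise_cons.1 h.srt).1 x hx) hab
  · intro x hx
    rcases List.mem_cons.1 hx with rfl | hx
    · exact hb
    · exact h.sub x hx
  · intro z hz hz'
    have h1 := reg_below h.srt z hz'
    have h2 : 0 < cross O a z := by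
      refine int_pos (ne_of_cross hab).1 ?_ hz
      apply hull3
      · rw [cross_aba]
      · rw [cross_abb]
      · exact hab.le
    have : cross a O z = - cross O a z := by simp only [cross]; ring
    linarith

theorem SPart.cut {O P Y c b a Z L} (hO : O ∈ P) (h : SPart O P (Y ++ c :: b :: a :: Z) L)
    (hc : cross a b c < 0) : SPart O P (Y ++ c :: a :: Z) (TT a b c :: L) := by
  have hs := h.srt
  have hY : Srt O (Y ++ [c]) := by
    refine List.Pairwise.sublist ?_ hs
    exact List.Sublist.append_left (by simp) _
  have hZ : Srt O (a :: Z) := by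
    refine List.Pairwise.sublist ?_ hs
    apply List.Sublist.trans _ (List.sublist_append_right _ _)
    exact ((List.Sublist.refl _).cons _).cons _
  have hsub : (Y ++ c :: a :: Z).Sublist (Y ++ c :: b :: a :: Z) :=
    List.Sublist.append_left (((List.Sublist.refl _).cons _).cons_cons _) _
  have hcba : Srt O (c :: b :: a :: Z) := hs.sublist (List.sublist_append_right _ _)
  simp only [Srt, List.pairwise_cons] at hcba
  have hbc := hcba.1 b (by simp)
  have hac := hcba.1 a (by simp)
  have hab := hcba.2.1 a (by simp)
  have hbac : 0 < cross b a c := by simp only [cross] at *; linarith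
  have haP : a ∈ P := h.sub a (by simp)
  have hbP : b ∈ P := h.sub b (by simp)
  have hcP : c ∈ P := h.sub c (by simp)
  have eT : TT a b c = TT b a c := by ext x; simp only [mem_TT]; tauto
  have hf : Face P (TT a b c) := by rw [eT]; exact face_tri hbac hbP haP hcP
  have hbT : b ∈ HH (TT O a c) := by
    rw [mem_tri hac]
    refine ⟨hab.le, ?_, ?_⟩ <;> simp only [cross] at * <;> linarith
  have hreg : HH (TT O a c) = HH (TT a b c) ∪ (HH (TT O b c) ∪ HH (TT O a b)) := by
    apply subset_antisymm
    · intro z hz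
      rw [mem_tri hac] at hz
      rw [eT, mem_union, mem_union, mem_tri hbac, mem_tri hbc, mem_tri hab]
      have id1 : cross b a c * cross b O z + cross b c O * cross b a z + cross b O a * cross b c z = 0 := by
        simp only [cross]; ring
      have p1 : 0 < cross b c O := by rw [cross_rot, cross_rot]; exact hbc
      have p2 : 0 < cross b O a := by rw [cross_rot]; exact hab
      have n1 : cross a b z = - cross b a z := by simp only [cross]; ring
      have n2 : cross c b z = - cross b c z := by simp only [cross]; ring
      have n3 : cross O b z = - cross b O z := by simp only [cross]; ring
      rw [n1, n2, n3]
      obtain ⟨z1, z2, z3⟩ := hz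
      by_cases k1 : 0 ≤ cross b a z
      · by_cases k2 : 0 ≤ -cross b c z
        · left; exact ⟨k1, z2, k2⟩
        · push Not at k2
          right
          by_cases k3 : 0 ≤ - cross b O z
          · left; exact ⟨k3, by linarith, z3⟩
          · exfalso
            push Not at k3
            have q1 := mul_pos hbac (show 0 < cross b O z by linarith)
            have q2 := mul_nonneg p1.le k1
            have q3 := mul_pos p2 (show 0 < cross b c z by linarith)
            linarith
      · push Not at k1
        right
        by_cases k3 : 0 ≤ cross b O z
        · right; exact ⟨z1, by linarith, k3⟩
        · left
          push Not at k3
          refine ⟨by linarith, ?_, z3⟩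
          by_contra k4
          push Not at k4
          have q1 := mul_neg_of_pos_of_neg hbac k3
          have q2 := mul_neg_of_pos_of_neg p1 k1
          have q3 := mul_neg_of_pos_of_neg p2 k4
          linarith
    · have hK : Convex ℝ (HH (TT O a c)) := convex_convexHull ℝ _
      have mm : ∀ x, (x = O ∨ x = a ∨ x = c) → x ∈ HH (TT O a c) :=
        fun x hx => subset_convexHull ℝ _ (Finset.mem_coe.2 (mem_TT.2 hx))
      refine union_subset ?_ (union_subset ?_ ?_)
      all_goals
        apply convexHull_min _ hK
        intro x hx
        rcases mem_TT.1 (Finset.mem_coe.1 hx) with rfl | rfl | rfl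
        all_goals first | exact hbT | (apply mm; tauto)
  refine h.add hf (hs.sublist hsub) (fun x hx => h.sub x (hsub.mem hx)) ?_ ?_
  · rw [reg_append O c (a :: Z) Y, reg_append O c (b :: a :: Z) Y, reg_cons, reg_cons, reg_cons, hreg]
    ext z; simp only [mem_union]; tauto
  · intro z hz hz'
    rw [eT] at hz
    have i1 : 0 < cross O a z := int_pos (ne_of_cross hab).1 (hull3 hab.le (by rw [cross_abb]) hac.le) hz
    have i2 : 0 < cross c O z := int_pos (ne_of_cross hac).2.2
      (hull3 (by rw [cross_rot]; exact hbc.le) (by rw [cross_rot]; exact hac.le) (by rw [cross_aba])) hz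
    have i3 : 0 < cross b a z := int_pos (ne_of_cross hbac).1 (hull3 (by rw [cross_aba]) (by rw [cross_abb]) hbac.le) hz
    have i4 : 0 < cross c b z := int_pos (ne_of_cross hbac).2.2
      (hull3 (by rw [cross_abb]) (by rw [cross_rot]; exact hbac.le) (by rw [cross_aba])) hz
    rw [reg_append O c (b :: a :: Z) Y, reg_cons, reg_cons] at hz'
    rcases hz' with hz' | hz' | hz' | hz'
    · have := reg_above hY z hz'
      have : cross O c z = - cross c O z := by simp only [cross]; ring
      linarith
    · rw [mem_tri hbc] at hz'
      have : cross b c z = - cross c b z := by simp only [cross]; ring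
      linarith [hz'.2.1]
    · rw [mem_tri hab] at hz'
      have : cross a b z = - cross b a z := by simp only [cross]; ring
      linarith [hz'.2.1]
    · have := reg_below hZ z hz'
      have : cross O a z = - cross a O z := by simp only [cross]; ring
      linarith

theorem SPart.ins {O P Y c b a Z L} (hT : AngTr O P) (hO : O ∈ P) (h : SPart O P (Y ++ c :: a :: Z) L)
    (hbP : b ∈ P) (hab : 0 < cross O a b) (hbc : 0 < cross O b c)
    (hc : 0 < cross a b c) : SPart O P (Y ++ c :: b :: a :: Z) (TT a b c :: L) := by
  have hs := h.srt
  have hY : Srt O (Y ++ [c]) := by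
    refine List.Pairwise.sublist ?_ hs
    exact List.Sublist.append_left (by simp) _
  have hZ : Srt O (a :: Z) := by
    refine List.Pairwise.sublist ?_ hs
    apply List.Sublist.trans _ (List.sublist_append_right _ _)
    exact ((List.Sublist.refl _).cons _)
  have hca : Srt O (c :: a :: Z) := hs.sublist (List.sublist_append_right _ _)
  simp only [Srt, List.pairwise_cons] at hca
  have hac := hca.1 a (by simp)
  have haP : a ∈ P := h.sub a (by simp)
  have hcP : c ∈ P := h.sub c (by simp)
  have hf : Face P (TT a b c) := face_tri hc haP hbP hcP
  have r1 : 0 < cross a b O := by rw [cross_rot, cross_rot]; exact hab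
  have r2 : 0 < cross b c O := by rw [cross_rot, cross_rot]; exact hbc
  have r3 : 0 < cross b c a := by rw [← cross_rot]; exact hc
  have r4 : 0 < cross c O b := by rw [cross_rot]; exact hbc
  have r5 : 0 < cross c O a := by rw [cross_rot]; exact hac
  have hreg : HH (TT O b c) ∪ HH (TT O a b) = HH (TT a b c) ∪ HH (TT O a c) := by
    ext z
    have n1 : cross c a z = - cross a c z := by simp only [cross]; ring
    have n2 : cross b O z = - cross O b z := by simp only [cross]; ring
    have hq : (z ∈ HH (TT O b c) ∨ z ∈ HH (TT O a b) ∨ z ∈ HH (TT a b c) ∨ z ∈ HH (TT O a c)) →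
       0 ≤ cross O a z ∧ 0 ≤ cross a b z ∧ 0 ≤ cross b c z ∧ 0 ≤ cross c O z := by
      rintro (hz | hz | hz | hz)
      all_goals
        refine ⟨hull3 ?_ ?_ ?_ z hz, hull3 ?_ ?_ ?_ z hz, hull3 ?_ ?_ ?_ z hz, hull3 ?_ ?_ ?_ z hz⟩
        all_goals first | (rw [cross_aba]) | (rw [cross_abb]) | (apply le_of_lt; assumption)
    constructor
    · rintro hz
      obtain ⟨k1, k2, k3, k4⟩ := hq (by rw [mem_union] at hz; tauto)
      rw [mem_union, mem_tri hc, mem_tri hac, n1]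
      by_cases k : 0 ≤ cross a c z
      · right; exact ⟨k1, k, k4⟩
      · left; exact ⟨k2, k3, by linarith⟩
    · rintro hz
      obtain ⟨k1, k2, k3, k4⟩ := hq (by rw [mem_union] at hz; tauto)
      rw [mem_union, mem_tri hbc, mem_tri hab, n2]
      by_cases k : 0 ≤ cross O b z
      · left; exact ⟨k, k3, k4⟩
      · right; exact ⟨k1, k2, by linarith⟩
  refine h.add hf ?_ ?_ ?_ ?_
  · rw [Srt, List.pairwise_append] at hs ⊢
    refine ⟨hs.1, ?_, ?_⟩
    · rw [List.pairwise_cons, List.pairwise_cons]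
      refine ⟨?_, ?_, hZ⟩
      · intro x hx
        rcases List.mem_cons.1 hx with rfl | hx
        · exact hbc
        · exact hca.1 x hx
      · intro x hx
        rcases List.mem_cons.1 hx with rfl | hx
        · exact hab
        · exact hT x (h.sub x (by simp [hx])) a haP b hbP (hca.2.1 x hx) hab
    · intro x hx y hy
      rcases List.mem_cons.1 hy with rfl | hy
      · exact hs.2.2 x hx _ (by simp)
      rcases List.mem_cons.1 hy with rfl | hy
      · exact hT _ hbP c hcP x (h.sub x (by simp [hx])) hbc (hs.2.2 x hx c (by simp))
      · exact hs.2.2 x hx y (by simp at hy ⊢; tauto)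
  · intro x hx
    have : x = b ∨ x ∈ Y ++ c :: a :: Z := by simp at hx ⊢; tauto
    rcases this with rfl | h1
    · exact hbP
    · exact h.sub x h1
  · rw [reg_append O c (a :: Z) Y, reg_append O c (b :: a :: Z) Y, reg_cons, reg_cons, reg_cons, ← union_assoc (HH (TT O b c)), hreg]
    ext z; simp only [mem_union]; tauto
  · intro z hz hz'
    have i1 : 0 < cross O a z := int_pos (ne_of_cross hab).1 (hull3 (by rw [cross_abb]) hab.le hac.le) hz
    have i2 : 0 < cross c O z := int_pos (ne_of_cross hac).2.2
      (hull3 r5.le r4.le (by rw [cross_aba])) hz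
    have i3 : 0 < cross c a z := int_pos (ne_of_cross hc).2.2 (hull3 (by rw [cross_abb]) (by rw [cross_rot]; exact hc.le) (by rw [cross_aba])) hz
    rw [reg_append O c (a :: Z) Y, reg_cons] at hz'
    rcases hz' with hz' | hz' | hz'
    · have := reg_above hY z hz'
      have : cross O c z = - cross c O z := by simp only [cross]; ring
      linarith
    · rw [mem_tri hac] at hz'
      have : cross a c z = - cross c a z := by simp only [cross]; ring
      linarith [hz'.2.1]
    · have := reg_below hZ z hz'
      have : cross O a z = - cross a O z := by simp only [cross]; ring
      linarith

theorem disj_closure {K A : Set Pt} (hA : Convex ℝ A) (hi : (interior A).Nonempty)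
    (h : Disjoint (interior A) (interior K)) : Disjoint A (interior K) := by
  have h1 : Disjoint (closure (interior A)) (interior K) := h.closure_left isOpen_interior
  rw [hA.closure_interior_eq_closure_of_nonempty_interior hi] at h1
  exact h1.mono_left subset_closure

theorem SPart.merge {O P C f g a b L} (h : SPart O P C (f :: g :: L)) (hm : MC f g a b) :
    SPart O P C ((f ∪ g) :: L) := by
  have hf := h.face f (by simp)
  have hg := h.face g (by simp)
  have hu : HH (f ∪ g) = HH f ∪ HH g := hm.hull
  refine ⟨h.srt, h.sub, ?_, ?_, ?_⟩
  · intro x hx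
    rcases List.mem_cons.1 hx with rfl | hx
    · refine ⟨Finset.union_subset hf.sub hg.sub, hf.card.trans (Finset.card_le_card Finset.subset_union_left), hm.ext hf.ext hg.ext, ?_⟩
      apply hf.int.mono
      apply interior_mono
      rw [hu]; exact subset_union_left
    · exact h.face x (by simp [hx])
  · have hd := h.disj
    simp only [List.pairwise_cons] at hd ⊢
    refine ⟨?_, hd.2.2⟩
    intro x hx
    have d1 := disj_closure (convex_convexHull ℝ _) hf.int (hd.1 x (by simp [hx]))
    have d2 := disj_closure (convex_convexHull ℝ _) hg.int (hd.2.1 x hx)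
    apply Disjoint.mono_left interior_subset
    rw [hu]; exact d1.union_left d2
  · intro z
    rw [← h.cov z]
    simp only [List.exists_mem_cons_iff]
    rw [hu, mem_union]; tauto


def QQ (O : Pt) (P : Finset Pt) (C : List Pt) (W : List (Finset Pt)) (s n : ℕ) (D : Set Pt) : Prop :=
  ∃ V, SPart O P C (W ++ V) ∧ (W ++ V).length + C.length + s ≤ n ∧ ∀ x ∈ D, ∃ f ∈ W ++ V, x ∈ f

theorem QQ.perm {O P C W W' s n D} (h : QQ O P C W s n D) (hp : W.Perm W') : QQ O P C W' s n D := by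
  obtain ⟨V, h1, h2, h3⟩ := h
  have hp' : (W ++ V).Perm (W' ++ V) := hp.append_right V
  refine ⟨V, h1.perm hp', ?_, ?_⟩
  · rw [← hp'.length_eq]; exact h2
  · intro x hx
    obtain ⟨f, hf, hxf⟩ := h3 x hx
    exact ⟨f, hp'.mem_iff.1 hf, hxf⟩

theorem QQ.swap {O P C f g W s n D} (h : QQ O P C (f :: g :: W) s n D) : QQ O P C (g :: f :: W) s n D :=
  h.perm (List.Perm.swap _ _ _)

theorem QQ.rot3 {O P C f g k W s n D} (h : QQ O P C (f :: g :: k :: W) s n D) :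
    QQ O P C (k :: f :: g :: W) s n D :=
  h.perm (((List.Perm.swap _ _ _).cons _).trans (List.Perm.swap _ _ _))

theorem QQ.drop {O P C f W s n D} (h : QQ O P C (f :: W) s n D) : QQ O P C W s n D := by
  obtain ⟨V, h1, h2, h3⟩ := h
  have hp' : ((f :: W) ++ V).Perm (W ++ (f :: V)) := by
    simpa using (List.perm_middle (a := f) (l₁ := W) (l₂ := V)).symm
  refine ⟨f :: V, h1.perm hp', ?_, ?_⟩
  · rw [← hp'.length_eq]; exact h2
  · intro x hx
    obtain ⟨f, hf, hxf⟩ := h3 x hx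
    exact ⟨f, hp'.mem_iff.1 hf, hxf⟩

theorem QQ.one {O P C f W s n D} (h : QQ O P C (f :: W) s n D) : QQ O P C [f] s n D := by
  induction W with
  | nil => exact h
  | cons g W ih => exact ih h.swap.drop

theorem QQ.mono {O P C W s n n' D D'} (h : QQ O P C W s n D) (hn : n ≤ n') (hD : D' ⊆ D) : QQ O P C W s n' D' := by
  obtain ⟨V, h1, h2, h3⟩ := h
  exact ⟨V, h1, h2.trans hn, fun x hx => h3 x (hD hx)⟩

theorem QQ.append {O P a Z W s n D b} (hT : AngTr O P) (hO : O ∈ P) (h : QQ O P (a :: Z) W s n D) (hb : b ∈ P)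
    (hab : 0 < cross O a b) : QQ O P (b :: a :: Z) (TT O a b :: W) s (n + 2) (insert b D) := by
  obtain ⟨V, h1, h2, h3⟩ := h
  refine ⟨V, h1.append hT hO hb hab, ?_, ?_⟩
  · simp only [List.cons_append, List.length_cons] at *; omega
  · intro x hx
    rcases hx with rfl | hx
    · exact ⟨TT O a x, by simp, by simp [mem_TT]⟩
    · obtain ⟨f, hf, hxf⟩ := h3 x hx
      exact ⟨f, by rw [List.cons_append]; exact List.mem_cons_of_mem _ hf, hxf⟩

theorem QQ.cut {O P c b a Z W s n D} (Y : List Pt) (hO : O ∈ P) (h : QQ O P (Y ++ c :: b :: a :: Z) W s n D)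
    (hc : cross a b c < 0) : QQ O P (Y ++ c :: a :: Z) (TT a b c :: W) s n D := by
  obtain ⟨V, h1, h2, h3⟩ := h
  refine ⟨V, h1.cut hO hc, ?_, ?_⟩
  · simp only [List.cons_append, List.length_cons, List.length_append] at *; omega
  · intro x hx
    obtain ⟨f, hf, hxf⟩ := h3 x hx
    exact ⟨f, by rw [List.cons_append]; exact List.mem_cons_of_mem _ hf, hxf⟩

theorem QQ.ins {O P c b a Z W s n D} (Y : List Pt) (hT : AngTr O P) (hO : O ∈ P) (h : QQ O P (Y ++ c :: a :: Z) W s n D)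
    (hbP : b ∈ P) (hab : 0 < cross O a b) (hbc : 0 < cross O b c)
    (hc : 0 < cross a b c) : QQ O P (Y ++ c :: b :: a :: Z) (TT a b c :: W) s (n + 2) (insert b D) := by
  obtain ⟨V, h1, h2, h3⟩ := h
  refine ⟨V, h1.ins hT hO hbP hab hbc hc, ?_, ?_⟩
  · simp only [List.cons_append, List.length_cons, List.length_append] at *; omega
  · intro x hx
    rcases hx with rfl | hx
    · exact ⟨TT a x c, by simp, by simp [mem_TT]⟩
    · obtain ⟨f, hf, hxf⟩ := h3 x hx
      exact ⟨f, by rw [List.cons_append]; exact List.mem_cons_of_mem _ hf, hxf⟩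

theorem QQ.merge {O P C f g a b W s n D} (h : QQ O P C (f :: g :: W) s n D) (hm : MC f g a b) :
    QQ O P C ((f ∪ g) :: W) (s + 1) n D := by
  obtain ⟨V, h1, h2, h3⟩ := h
  refine ⟨V, SPart.merge h1 hm, ?_, ?_⟩
  · simp only [List.cons_append, List.length_cons, List.length_append] at *; omega
  · intro x hx
    obtain ⟨k, hf, hxf⟩ := h3 x hx
    simp only [List.cons_append, List.mem_cons] at hf ⊢
    rcases hf with rfl | rfl | hf
    · exact ⟨_, Or.inl rfl, Finset.mem_union_left _ hxf⟩
    · exact ⟨_, Or.inl rfl, Finset.mem_union_right _ hxf⟩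
    · exact ⟨k, Or.inr hf, hxf⟩

theorem QQ.fsub {O P C f W s n D} (h : QQ O P C (f :: W) s n D) : f ⊆ P := by
  obtain ⟨V, h1, h2, h3⟩ := h
  exact (h1.face f (by simp)).sub

theorem QQ.csub {O P C W s n D} (h : QQ O P C W s n D) : ∀ x ∈ C, x ∈ P := by
  obtain ⟨V, h1, h2, h3⟩ := h
  exact h1.sub

/-- four point lemmas -/
theorem fp1 (O x b c y : Pt) : cross O b c * cross x c y = cross O x c * cross b c y + cross O c y * cross x b c := by
  simp only [cross]; ring
theorem fp2 (O x b c y : Pt) : cross O b c * cross x b y = cross O b y * cross x b c + cross O x b * cross b c y := by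
  simp only [cross]; ring

theorem pp1 {O x b c y : Pt} (h1 : 0 < cross O b c) (h2 : 0 < cross O x c) (h3 : 0 < cross O c y)
    (h4 : 0 < cross x b c) (h5 : 0 < cross b c y) : 0 < cross x c y := by
  have := fp1 O x b c y
  have a1 := mul_pos h2 h5
  have a2 := mul_pos h3 h4
  exact pos_of_mul_pos_right (by linarith : 0 < cross O b c * cross x c y) h1.le
theorem nn1 {O x b c y : Pt} (h1 : 0 < cross O b c) (h2 : 0 < cross O x c) (h3 : 0 < cross O c y)
    (h4 : cross x b c < 0) (h5 : cross b c y < 0) : cross x c y < 0 := by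
  have := fp1 O x b c y
  have a1 := mul_neg_of_pos_of_neg h2 h5
  have a2 := mul_neg_of_pos_of_neg h3 h4
  exact neg_of_mul_neg_right (by linarith : cross O b c * cross x c y < 0) h1.le
theorem nn2 {O x b c y : Pt} (h1 : 0 < cross O b c) (h2 : 0 < cross O b y) (h3 : 0 < cross O x b)
    (h4 : cross x b c < 0) (h5 : cross b c y < 0) : cross x b y < 0 := by
  have := fp2 O x b c y
  have a1 := mul_neg_of_pos_of_neg h2 h4
  have a2 := mul_neg_of_pos_of_neg h3 h5
  exact neg_of_mul_neg_right (by linarith : cross O b c * cross x b y < 0) h1.le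
theorem kk1 {O x b c y : Pt} (h1 : 0 < cross O b c) (h2 : 0 < cross O x c) (h3 : 0 < cross O c y)
    (h4 : cross x b c < 0) (h5 : 0 < cross x c y) : 0 < cross b c y := by
  have := fp1 O x b c y
  have a1 := mul_pos h1 h5
  have a2 := mul_neg_of_pos_of_neg h3 h4
  exact pos_of_mul_pos_right (by linarith : 0 < cross O x c * cross b c y) h2.le
theorem kk2 {O x b c y : Pt} (h1 : 0 < cross O b c) (h2 : 0 < cross O b y) (h3 : 0 < cross O x b)
    (h4 : cross b c y < 0) (h5 : 0 < cross x b y) : 0 < cross x b c := by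
  have := fp2 O x b c y
  have a1 := mul_pos h1 h5
  have a2 := mul_neg_of_pos_of_neg h3 h4
  exact pos_of_mul_pos_right (by linarith : 0 < cross O b y * cross x b c) h2.le

structure FInv (O : Pt) (f : Finset Pt) (q r : Pt) : Prop where
  hO : O ∈ f
  hr : r ∈ f
  qr : 0 < cross O q r
  all : ∀ x ∈ f, x = O ∨ x = r ∨ x = q ∨ (0 < cross O x q ∧ 0 < cross x q r)

theorem FInv.tri {O q r : Pt} (h : 0 < cross O q r) : FInv O (TT O q r) q r :=
  ⟨by simp [mem_TT], by simp [mem_TT], h, fun x hx => by rw [mem_TT] at hx; tauto⟩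

theorem pos_cyc {a b c : Pt} (h : 0 < cross a b c) : 0 < cross b c a := by rw [← cross_rot]; exact h
theorem pos_rev {a b c : Pt} (h : cross a b c < 0) : 0 < cross c b a := by rw [cross_swap]; linarith

theorem finv_mc {O P f q r y} (hT : AngTr O P) (hf : f ⊆ P) (h : FInv O f q r) (hq : q ∈ P) (hy : y ∈ P)
    (h1 : 0 < cross O r y) (h2 : 0 < cross q r y) : MC f (TT O r y) r O ∧ FInv O (f ∪ TT O r y) r y := by
  have hr := hf h.hr
  have key : ∀ x ∈ f, x = O ∨ x = r ∨ (0 < cross O x r ∧ 0 < cross x r y) := by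
    intro x hx
    rcases h.all x hx with e | e | e | ⟨e1, e2⟩
    · exact Or.inl e
    · exact Or.inr (Or.inl e)
    · subst e; exact Or.inr (Or.inr ⟨h.qr, h2⟩)
    · have := hT x (hf hx) q hq r hr e1 h.qr
      exact Or.inr (Or.inr ⟨this, pp1 h.qr this h1 e2 h2⟩)
  constructor
  · refine ⟨h.hr, h.hO, by simp [mem_TT], by simp [mem_TT], ?_, ?_, ?_⟩
    · intro x hx
      rcases key x hx with e | e | ⟨e1, e2⟩
      · tauto
      · tauto
      · right; right; exact pos_cyc (pos_cyc e1)
    · intro x hx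
      rcases mem_TT.1 hx with rfl | rfl | rfl
      · tauto
      · tauto
      · exact Or.inr (Or.inr h1)
    · intro x hx z hz
      rcases key x hx with e | e | ⟨e1, e2⟩
      · tauto
      · tauto
      rcases mem_TT.1 hz with rfl | rfl | rfl
      · tauto
      · tauto
      · right; right; right; right
        refine ⟨e2, ?_⟩
        exact pos_cyc (pos_cyc (hT x (hf hx) r hr z hy e1 h1))
  · refine ⟨Finset.mem_union_left _ h.hO, Finset.mem_union_right _ (by simp [mem_TT]), h1, ?_⟩
    intro x hx
    rcases Finset.mem_union.1 hx with hx | hx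
    · have := key x hx; tauto
    · rw [mem_TT] at hx; tauto

theorem QQ.am {O P r Z f W s n D q y} (hT : AngTr O P) (hO : O ∈ P) (h : QQ O P (r :: Z) (f :: W) s n D)
    (hF : FInv O f q r) (hq : q ∈ P) (hy : y ∈ P) (h1 : 0 < cross O r y) (h2 : 0 < cross q r y) :
    ∃ f', QQ O P (y :: r :: Z) (f' :: W) (s + 1) (n + 2) (insert y D) ∧ FInv O f' r y := by
  obtain ⟨m1, m2⟩ := finv_mc hT h.fsub hF hq hy h1 h2
  have := (h.append hT hO hy h1).swap.merge m1
  exact ⟨_, this, m2⟩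

structure Cfg (O : Pt) (P : Finset Pt) (p : ℕ → Pt) (N : ℕ) : Prop where
  hO : O ∈ P
  gp : GenPos P
  tr : AngTr O P
  mem : ∀ i ≤ N + 1, p i ∈ P
  ord : ∀ i j, i < j → j ≤ N + 1 → 0 < cross O (p i) (p j)

def DD (O : Pt) (p : ℕ → Pt) (t : ℕ) : Set Pt := {x | x = O ∨ ∃ i ≤ t + 1, x = p i}

theorem DD_succ (O : Pt) (p : ℕ → Pt) (t : ℕ) : DD O p (t + 1) ⊆ insert (p (t + 2)) (DD O p t) := by
  rintro x (hx | ⟨i, hi, hx⟩)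
  · exact Or.inr (Or.inl hx)
  · rcases Nat.lt_or_ge i (t + 2) with h | h
    · exact Or.inr (Or.inr ⟨i, by omega, hx⟩)
    · have : i = t + 2 := by omega
      subst this; exact Or.inl hx

def BB (O : Pt) (P : Finset Pt) (p : ℕ → Pt) (t s : ℕ) : Prop :=
  ∃ Z f, QQ O P (p (t + 1) :: Z) [f] s (2 * t + 3) (DD O p t) ∧ FInv O f (p t) (p (t + 1))

def EE (O : Pt) (P : Finset Pt) (p : ℕ → Pt) (t s : ℕ) : Prop :=
  ∃ Z f, QQ O P (p (t + 1) :: p t :: Z) [f] s (2 * t + 3) (DD O p t) ∧ FInv O f (p t) (p (t + 1))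

structure GInv (O : Pt) (g : Finset Pt) (u q r : Pt) : Prop where
  ug : u ∈ g
  rg : r ∈ g
  uq : 0 < cross O u q
  uqr : cross u q r < 0
  all : ∀ x ∈ g, x = u ∨ x = r ∨ (0 < cross O u x ∧ cross u x r < 0 ∧
    (x = q ∨ (0 < cross O x q ∧ cross x q r < 0)))

def GG (O : Pt) (P : Finset Pt) (p : ℕ → Pt) (t s : ℕ) : Prop :=
  ∃ u Z f g, QQ O P (p (t + 1) :: u :: Z) [f, g] s (2 * t + 3) (DD O p t) ∧ FInv O f (p t) (p (t + 1)) ∧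
    GInv O g u (p t) (p (t + 1))

theorem EB {O P p t s} (h : EE O P p t s) : BB O P p t s := by
  obtain ⟨Z, f, h1, h2⟩ := h; exact ⟨_, f, h1, h2⟩
theorem GB {O P p t s} (h : GG O P p t s) : BB O P p t s := by
  obtain ⟨u, Z, f, g, h1, h2, _⟩ := h; exact ⟨_, f, h1.one, h2⟩

def cap (p : ℕ → Pt) (t : ℕ) : Prop := 0 < cross (p t) (p (t + 1)) (p (t + 2))
def gud (p : ℕ → Pt) (t : ℕ) : Prop := 0 < cross (p t) (p (t + 2)) (p (t + 4))

theorem Cfg.ne {O P p N} (c : Cfg O P p N) {i j : ℕ} (h : i < j) (hj : j ≤ N + 1) : p i ≠ p j :=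
  (ne_of_cross (c.ord i j h hj)).2.1

theorem Cfg.neg {O P p N} (c : Cfg O P p N) {i j k : ℕ} (h : i < j) (h' : j < k) (hk : k ≤ N + 1)
    (hn : ¬ 0 < cross (p i) (p j) (p k)) : cross (p i) (p j) (p k) < 0 := by
  have := c.gp _ (c.mem i (by omega)) _ (c.mem j (by omega)) _ (c.mem k hk) (c.ne h (by omega)) (c.ne h' hk)
    (c.ne (h.trans h') hk)
  exact lt_of_le_of_ne (not_lt.1 hn) this

theorem TB1 {O P p N t s} (c : Cfg O P p N) (h : BB O P p t s) (ht : t < N) (hc : cap p t) :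
    EE O P p (t + 1) (s + 1) := by
  obtain ⟨Z, f, h1, h2⟩ := h
  obtain ⟨f', h3, h4⟩ := h1.am c.tr c.hO h2 (c.mem t (by omega)) (c.mem (t + 2) (by omega))
    (c.ord _ _ (by omega) (by omega)) hc
  exact ⟨_, f', h3.mono (by omega) (DD_succ _ _ _), h4⟩

theorem TB0 {O P p N t s} (c : Cfg O P p N) (h : BB O P p t s) (ht : t < N) : EE O P p (t + 1) s := by
  obtain ⟨Z, f, h1, h2⟩ := h
  have h3 := h1.append c.tr c.hO (c.mem (t + 2) (by omega)) (c.ord (t + 1) (t + 2) (by omega) (by omega))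
  exact ⟨_, _, h3.one.mono (by omega) (DD_succ _ _ _), FInv.tri (c.ord (t + 1) (t + 2) (by omega) (by omega))⟩

theorem TEG {O P p N t s} (c : Cfg O P p N) (h : EE O P p t s) (ht : t < N) (hc : ¬ cap p t) :
    GG O P p (t + 1) s := by
  obtain ⟨Z, f, h1, h2⟩ := h
  have o1 := c.ord (t + 1) (t + 2) (by omega) (by omega)
  have o0 := c.ord t (t + 1) (by omega) (by omega)
  have hneg := c.neg (i := t) (j := t + 1) (k := t + 2) (by omega) (by omega) (by omega) hc
  have h3 := h1.append c.tr c.hO (c.mem (t + 2) (by omega)) o1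
  have h4 := QQ.cut [] c.hO h3 hneg
  refine ⟨p t, Z, TT O (p (t + 1)) (p (t + 2)), TT (p t) (p (t + 1)) (p (t + 2)), ?_, FInv.tri o1, ?_⟩
  · exact (h4.rot3.drop.swap).mono (by omega) (DD_succ _ _ _)
  · refine ⟨by simp [mem_TT], by simp [mem_TT], o0, hneg, ?_⟩
    intro x hx
    rcases mem_TT.1 hx with rfl | rfl | rfl
    · left; rfl
    · right; right; exact ⟨o0, hneg, Or.inl rfl⟩
    · right; left; rfl

theorem ginv_step {O P g u q r y} (hT : AngTr O P) (hg : g ⊆ P) (h : GInv O g u q r) (hq : q ∈ P) (hy : y ∈ P)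
    (hqr : 0 < cross O q r) (hry : 0 < cross O r y) (hc : cross q r y < 0) :
    cross u r y < 0 ∧ MC g (TT u r y) u r ∧ GInv O (g ∪ TT u r y) u r y := by
  have hu := hg h.ug
  have hr := hg h.rg
  have hur := hT u hu q hq r hr h.uq hqr
  have hury : cross u r y < 0 := nn1 hqr hur hry h.uqr hc
  have key : ∀ x ∈ g, x = u ∨ x = r ∨ (0 < cross O u x ∧ 0 < cross O x r ∧ cross u x r < 0 ∧ cross x r y < 0 ∧ cross u x y < 0) := by
    intro x hx
    rcases h.all x hx with e | e | ⟨e1, e2, e3⟩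
    · tauto
    · tauto
    right; right
    have hxr : 0 < cross O x r := by
      rcases e3 with e3 | ⟨e3, e4⟩
      · rw [e3]; exact hqr
      · exact hT x (hg hx) q hq r hr e3 hqr
    have hxry : cross x r y < 0 := by
      rcases e3 with e3 | ⟨e3, e4⟩
      · rw [e3]; exact hc
      · exact nn1 hqr hxr hry e4 hc
    have hxy := hT x (hg hx) r hr y hy hxr hry
    exact ⟨e1, hxr, e2, hxry, nn2 hxr hxy e1 e2 hxry⟩
  refine ⟨hury, ?_, ?_⟩
  · refine ⟨h.ug, h.rg, by simp [mem_TT], by simp [mem_TT], ?_, ?_, ?_⟩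
    · intro x hx
      rcases key x hx with e | e | ⟨e1, e2, e3, e4, e5⟩
      · tauto
      · tauto
      · right; right; exact pos_cyc (pos_cyc (pos_rev e3))
    · intro x hx
      rcases mem_TT.1 hx with rfl | rfl | rfl
      · tauto
      · tauto
      · right; right; exact pos_cyc (pos_rev hury)
    · intro x hx z hz
      rcases key x hx with e | e | ⟨e1, e2, e3, e4, e5⟩
      · tauto
      · tauto
      rcases mem_TT.1 hz with rfl | rfl | rfl
      · tauto
      · tauto
      · right; right; right; right
        exact ⟨pos_cyc (pos_rev e5), pos_rev e4⟩
  · refine ⟨Finset.mem_union_left _ h.ug, Finset.mem_union_right _ (by simp [mem_TT]), hur, hury, ?_⟩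
    intro x hx
    rcases Finset.mem_union.1 hx with hx | hx
    · rcases key x hx with e | e | ⟨e1, e2, e3, e4, e5⟩
      · tauto
      · subst e; tauto
      · tauto
    · rcases mem_TT.1 hx with rfl | rfl | rfl <;> tauto

theorem TGG {O P p N t s} (c : Cfg O P p N) (h : GG O P p t s) (ht : t < N) (hc : ¬ cap p t) :
    GG O P p (t + 1) (s + 1) := by
  obtain ⟨u, Z, f, g, h1, h2, h3⟩ := h
  have o1 := c.ord (t + 1) (t + 2) (by omega) (by omega)
  have o0 := c.ord t (t + 1) (by omega) (by omega)
  have hneg := c.neg (i := t) (j := t + 1) (k := t + 2) (by omega) (by omega) (by omega) hc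
  obtain ⟨k1, k2, k3⟩ := ginv_step c.tr h1.swap.fsub h3 (c.mem t (by omega)) (c.mem (t + 2) (by omega)) o0 o1 hneg
  have h4 := h1.append c.tr c.hO (c.mem (t + 2) (by omega)) o1
  have h5 := QQ.cut [] c.hO h4 k1
  have h6 := (h5.rot3.drop.rot3.merge k2).swap
  exact ⟨u, Z, _, _, h6.mono (by omega) (DD_succ _ _ _), FInv.tri o1, k3⟩


theorem neg_comm12 {a b c : Pt} (h : cross a b c < 0) : 0 < cross b a c := by
  have : cross b a c = - cross a b c := by simp only [cross]; ring
  linarith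

/-- merging of two triangles a b x and b a y -/
theorem mc_tri {p q : Finset Pt} {a b x y : Pt} (hp : ∀ z, z ∈ p ↔ z = a ∨ z = b ∨ z = x)
    (hq : ∀ z, z ∈ q ↔ z = a ∨ z = b ∨ z = y) (h1 : 0 < cross a b x) (h2 : 0 < cross b a y)
    (h3 : 0 < cross x a y) (h4 : 0 < cross y b x) : MC p q a b := by
  refine ⟨by simp [hp], by simp [hp], by simp [hq], by simp [hq], ?_, ?_, ?_⟩
  · intro z hz
    rcases (hp z).1 hz with rfl | rfl | rfl <;> tauto
  · intro z hz
    rcases (hq z).1 hz with rfl | rfl | rfl <;> tauto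
  · intro z hz w hw
    rcases (hp z).1 hz with rfl | rfl | rfl
    · tauto
    · tauto
    rcases (hq w).1 hw with rfl | rfl | rfl <;> tauto

theorem mc_quad {p q : Finset Pt} {a b x x' y : Pt} (hp : ∀ z, z ∈ p ↔ z = a ∨ z = b ∨ z = x ∨ z = x')
    (hq : ∀ z, z ∈ q ↔ z = a ∨ z = b ∨ z = y) (h1 : 0 < cross a b x) (h1' : 0 < cross a b x') (h2 : 0 < cross b a y)
    (h3 : 0 < cross x a y) (h3' : 0 < cross x' a y) (h4 : 0 < cross y b x) (h4' : 0 < cross y b x') : MC p q a b := by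
  refine ⟨by simp [hp], by simp [hp], by simp [hq], by simp [hq], ?_, ?_, ?_⟩
  · intro z hz
    rcases (hp z).1 hz with rfl | rfl | rfl | rfl
    · exact Or.inl rfl
    · exact Or.inr (Or.inl rfl)
    · exact Or.inr (Or.inr h1)
    · exact Or.inr (Or.inr h1')
  · intro z hz
    rcases (hq z).1 hz with rfl | rfl | rfl
    · exact Or.inl rfl
    · exact Or.inr (Or.inl rfl)
    · exact Or.inr (Or.inr h2)
  · intro z hz w hw
    rcases (hp z).1 hz with rfl | rfl | rfl | rfl
    · exact Or.inl rfl
    · exact Or.inr (Or.inl rfl)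
    · rcases (hq w).1 hw with rfl | rfl | rfl
      · exact Or.inr (Or.inr (Or.inl rfl))
      · exact Or.inr (Or.inr (Or.inr (Or.inl rfl)))
      · exact Or.inr (Or.inr (Or.inr (Or.inr ⟨h3, h4⟩)))
    · rcases (hq w).1 hw with rfl | rfl | rfl
      · exact Or.inr (Or.inr (Or.inl rfl))
      · exact Or.inr (Or.inr (Or.inr (Or.inl rfl)))
      · exact Or.inr (Or.inr (Or.inr (Or.inr ⟨h3', h4'⟩)))

theorem good_step {O P} (hT : AngTr O P) (hO : O ∈ P) {u1 l1 u2 l2 u3 : Pt} {Z f s n D}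
    (hq : QQ O P (l1 :: u1 :: Z) [f] s n D) (hF : FInv O f u1 l1)
    (m3 : u2 ∈ P) (m4 : l2 ∈ P) (m5 : u3 ∈ P)
    (o23 : 0 < cross O l1 u2) (o34 : 0 < cross O u2 l2) (o45 : 0 < cross O l2 u3)
    (t1 : cross u1 l1 u2 < 0) (t2 : 0 < cross l1 u2 l2) (t3 : cross u2 l2 u3 < 0)
    (hg : 0 < cross u1 u2 u3)
    (n1 : ¬ 0 < cross u1 l1 l2 → cross u1 l1 l2 < 0) (n2 : ¬ 0 < cross l1 l2 u3 → cross l1 l2 u3 < 0) :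
    ∃ Z' f', QQ O P (u3 :: Z') [f'] (s + 2) (n + 6) (insert l2 (insert u2 (insert u3 D))) ∧ FInv O f' l2 u3 := by
  have m1 : u1 ∈ P := hq.csub u1 (by simp)
  have m2 : l1 ∈ P := hq.csub l1 (by simp)
  have o12 := hF.qr
  have o13 := hT _ m1 _ m2 _ m3 o12 o23
  have o14 := hT _ m1 _ m3 _ m4 o13 o34
  have o24 := hT _ m2 _ m3 _ m4 o23 o34
  have o25 := hT _ m2 _ m4 _ m5 o24 o45
  have o35 := hT _ m3 _ m4 _ m5 o34 o45
  have k1 : 0 < cross u1 u2 l2 := kk2 o34 o35 o13 t3 hg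
  have k2 : 0 < cross l1 u2 u3 := kk1 o23 o13 o35 t1 hg
  by_cases c1 : 0 < cross u1 l1 l2
  · obtain ⟨f', q1, F1⟩ := hq.am hT hO hF m1 m4 o24 c1
    have q2 := QQ.ins [] hT hO q1 m3 o23 o34 t2
    by_cases c2 : 0 < cross l1 l2 u3
    · obtain ⟨f'', q3, F2⟩ := q2.swap.am hT hO F1 m2 m5 o45 c2
      refine ⟨_, f'', q3.one.mono (by omega) ?_, F2⟩
      intro x; simp only [Set.mem_insert_iff]; tauto
    · have c2' := n2 c2
      have q3 := q2.append hT hO m5 o45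
      have q4 := QQ.cut [] hO q3 t3
      have mc : MC (TT l1 u2 l2) (TT u2 l2 u3) u2 l2 := by
        refine mc_tri (x := l1) (y := u3) ?_ ?_ (pos_cyc t2) (neg_comm12 t3) k2 (pos_rev c2')
        · intro z; rw [mem_TT]; tauto
        · intro z; rw [mem_TT]
      have q7 := ((q4.rot3.merge (a := u2) (b := l2) mc).swap).one
      refine ⟨_, _, q7.mono (by omega) ?_, FInv.tri o45⟩
      intro x; simp only [Set.mem_insert_iff]; tauto
  · have c1' := n1 c1
    have q1 := hq.append hT hO m4 o24
    have q2 := QQ.ins [] hT hO q1 m3 o23 o34 t2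
    have q3 := QQ.cut [l2] hO q2 t1
    have mc : MC (TT u1 l1 u2) (TT l1 u2 l2) u2 l1 := by
      refine mc_tri (x := u1) (y := l2) ?_ ?_ (pos_rev t1) t2 k1 (pos_rev c1')
      · intro z; rw [mem_TT]; tauto
      · intro z; rw [mem_TT]; tauto
    have q4 := q3.merge mc
    by_cases c2 : 0 < cross l1 l2 u3
    · obtain ⟨f'', q5, F2⟩ := QQ.am (Z := [u2] ++ (u1 :: Z)) hT hO q4.swap (FInv.tri o24) m2 m5 o45 c2
      refine ⟨_, f'', q5.one.mono (by omega) ?_, F2⟩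
      intro x; simp only [Set.mem_insert_iff]; tauto
    · have c2' := n2 c2
      have q5 := QQ.append (Z := [u2] ++ (u1 :: Z)) hT hO q4 m5 o45
      have q6 := QQ.cut [] hO q5 t3
      have c3 : cross u1 l2 u3 < 0 := nn1 o24 o14 o45 c1' c2'
      have mc2 : MC (TT u1 l1 u2 ∪ TT l1 u2 l2) (TT u2 l2 u3) u2 l2 := by
        have hp : ∀ z, z ∈ TT u1 l1 u2 ∪ TT l1 u2 l2 ↔ z = u2 ∨ z = l2 ∨ z = u1 ∨ z = l1 := by
          intro z; rw [Finset.mem_union, mem_TT, mem_TT]; tauto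
        exact mc_quad hp (fun z => mem_TT) (pos_cyc k1) (pos_cyc t2) (neg_comm12 t3) hg k2 (pos_rev c3) (pos_rev c2')
      have q7 := ((q6.rot3.merge mc2).swap).one
      refine ⟨_, _, q7.mono (by omega) ?_, FInv.tri o45⟩
      intro x; simp only [Set.mem_insert_iff]; tauto

theorem dbl_step {O P} (hT : AngTr O P) (hO : O ∈ P) {u1 l1 u2 l2 u3 l3 u4 : Pt} {Z f s n D}
    (hq : QQ O P (l1 :: u1 :: Z) [f] s n D) (hF : FInv O f u1 l1)
    (m3 : u2 ∈ P) (m4 : l2 ∈ P) (m5 : u3 ∈ P) (m6 : l3 ∈ P) (m7 : u4 ∈ P)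
    (o23 : 0 < cross O l1 u2) (o34 : 0 < cross O u2 l2) (o45 : 0 < cross O l2 u3)
    (o56 : 0 < cross O u3 l3) (o67 : 0 < cross O l3 u4)
    (t1 : cross u1 l1 u2 < 0) (t2 : 0 < cross l1 u2 l2) (t3 : cross u2 l2 u3 < 0)
    (t4 : 0 < cross l2 u3 l3) (t5 : cross u3 l3 u4 < 0)
    (b1 : cross u1 u2 u3 < 0) (b2 : cross u2 u3 u4 < 0) :
    ∃ Z' f', QQ O P (u4 :: Z') [f'] (s + 3) (n + 10)
      (insert u4 (insert l3 (insert u3 (insert l2 (insert u2 D))))) ∧ FInv O f' l3 u4 := by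
  have m1 : u1 ∈ P := hq.csub u1 (by simp)
  have m2 : l1 ∈ P := hq.csub l1 (by simp)
  have o12 := hF.qr
  have o13 := hT _ m1 _ m2 _ m3 o12 o23
  have o35 := hT _ m3 _ m4 _ m5 o34 o45
  have o15 := hT _ m1 _ m3 _ m5 o13 o35
  have o57 := hT _ m5 _ m6 _ m7 o56 o67
  have o37 := hT _ m3 _ m5 _ m7 o35 o57
  have b3 : cross u1 u3 u4 < 0 := nn1 o35 o15 o57 b1 b2
  have b4 : cross u1 u2 u4 < 0 := nn2 o35 o37 o13 b1 b2
  have q1 := hq.append hT hO m3 o23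
  have q2 := (QQ.cut [] hO q1 t1).drop.one
  obtain ⟨f', q3, F3⟩ := QQ.am (Z := u1 :: Z) hT hO q2 (FInv.tri o23) m2 m4 o34 t2
  have q4 := q3.append hT hO m5 o45
  have q5 := QQ.cut [] hO q4 t3
  have q6 := (QQ.cut [] hO q5.drop.one b1).swap
  obtain ⟨f'', q7, F7⟩ := QQ.am (Z := u1 :: Z) hT hO q6 (FInv.tri o45) m4 m6 o56 t4
  have q8 := q7.append hT hO m7 o67
  have q9 := (QQ.cut [] hO q8 t5).drop
  have q10 := QQ.cut [] hO q9 b3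
  have mc : MC (TT u1 u2 u3) (TT u1 u3 u4) u1 u3 := by
    refine mc_tri (x := u2) (y := u4) ?_ ?_ (pos_cyc (pos_cyc (pos_rev b1))) (neg_comm12 b3)
      (neg_comm12 b4) (pos_rev b2)
    · intro z; rw [mem_TT]; tauto
    · intro z; rw [mem_TT]
  have q13 := q10.swap.rot3.drop.rot3.rot3.swap
  have q14 := (q13.merge mc).swap.one
  refine ⟨_, _, q14.mono (by omega) ?_, FInv.tri o67⟩
  intro x; simp only [Set.mem_insert_iff]; tauto

theorem TGood {O P p N t s} (c : Cfg O P p N) (h : EE O P p t s) (ht : t + 3 ≤ N) (h0 : ¬ cap p t)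
    (h1 : cap p (t + 1)) (h2 : ¬ cap p (t + 2)) (hg : gud p t) : BB O P p (t + 3) (s + 2) := by
  obtain ⟨Z, f, q, F⟩ := h
  obtain ⟨Z', f', q', F'⟩ := good_step c.tr c.hO q F (c.mem (t + 2) (by omega)) (c.mem (t + 3) (by omega))
    (c.mem (t + 4) (by omega)) (c.ord _ _ (by omega) (by omega)) (c.ord _ _ (by omega) (by omega))
    (c.ord _ _ (by omega) (by omega)) (c.neg (by omega) (by omega) (by omega) h0) h1
    (c.neg (by omega) (by omega) (by omega) h2) hg (c.neg (by omega) (by omega) (by omega))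
    (c.neg (by omega) (by omega) (by omega))
  refine ⟨Z', f', q'.mono (by omega) ?_, F'⟩
  intro x hx
  have a := DD_succ O p (t + 2) hx
  simp only [Set.mem_insert_iff] at a ⊢
  rcases a with a | a
  · tauto
  have a := DD_succ O p (t + 1) a
  simp only [Set.mem_insert_iff] at a
  rcases a with a | a
  · tauto
  have a := DD_succ O p (t) a
  simp only [Set.mem_insert_iff] at a
  tauto

theorem TDbl {O P p N t s} (c : Cfg O P p N) (h : EE O P p t s) (ht : t + 5 ≤ N) (h0 : ¬ cap p t)
    (h1 : cap p (t + 1)) (h2 : ¬ cap p (t + 2)) (h3 : cap p (t + 3)) (h4 : ¬ cap p (t + 4))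
    (hg : ¬ gud p t) (hg' : ¬ gud p (t + 2)) : BB O P p (t + 5) (s + 3) := by
  obtain ⟨Z, f, q, F⟩ := h
  obtain ⟨Z', f', q', F'⟩ := dbl_step c.tr c.hO q F (c.mem (t + 2) (by omega)) (c.mem (t + 3) (by omega))
    (c.mem (t + 4) (by omega)) (c.mem (t + 5) (by omega)) (c.mem (t + 6) (by omega))
    (c.ord _ _ (by omega) (by omega)) (c.ord _ _ (by omega) (by omega))
    (c.ord _ _ (by omega) (by omega)) (c.ord _ _ (by omega) (by omega)) (c.ord _ _ (by omega) (by omega))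
    (c.neg (by omega) (by omega) (by omega) h0) h1
    (c.neg (by omega) (by omega) (by omega) h2) h3 (c.neg (by omega) (by omega) (by omega) h4)
    (c.neg (by omega) (by omega) (by omega) hg)
    (c.neg (by omega) (by omega) (by omega) hg')
  refine ⟨Z', f', q'.mono (by omega) ?_, F'⟩
  intro x hx
  have a := DD_succ O p (t + 4) hx
  simp only [Set.mem_insert_iff] at a ⊢
  rcases a with a | a
  · tauto
  have a := DD_succ O p (t + 3) a
  simp only [Set.mem_insert_iff] at a
  rcases a with a | a
  · tauto
  have a := DD_succ O p (t + 2) a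
  simp only [Set.mem_insert_iff] at a
  rcases a with a | a
  · tauto
  have a := DD_succ O p (t + 1) a
  simp only [Set.mem_insert_iff] at a
  rcases a with a | a
  · tauto
  have a := DD_succ O p (t) a
  simp only [Set.mem_insert_iff] at a
  tauto


section comb
variable {E B G : ℕ → ℕ → Prop} {cp gd : ℕ → Prop} {N : ℕ}

theorem grun (GB : ∀ t s, G t s → B t s)
    (B1 : ∀ t s, B t s → t < N → cp t → E (t + 1) (s + 1))
    (G1 : ∀ t s, G t s → t < N → ¬ cp t → G (t + 1) (s + 1)) :
    ∀ k t s, N = t + k → G t s → (∃ s', B N s' ∧ (7 * s' - 4 * N : ℤ) ≥ 7 * s - 4 * t) ∨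
      ∃ t' s', t < t' ∧ t' ≤ N ∧ E t' s' ∧ (7 * s' - 4 * t' : ℤ) ≥ 7 * s - 4 * t + 3 := by
  intro k
  induction k with
  | zero => intro t s h hG; left; subst h; exact ⟨s, GB _ _ hG, by simp⟩
  | succ k ih =>
    intro t s h hG
    by_cases hc : cp t
    · right
      refine ⟨t + 1, s + 1, by omega, by omega, B1 _ _ (GB _ _ hG) (by omega) hc, by push_cast; omega⟩
    · rcases ih (t + 1) (s + 1) (by omega) (G1 _ _ hG (by omega) hc) with ⟨s', h1, h2⟩ | ⟨t', s', h1, h2, h3, h4⟩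
      · left; exact ⟨s', h1, by push_cast at *; omega⟩
      · right; exact ⟨t', s', by omega, h2, h3, by push_cast at *; omega⟩

theorem comb (EB : ∀ t s, E t s → B t s) (GB : ∀ t s, G t s → B t s)
    (B1 : ∀ t s, B t s → t < N → cp t → E (t + 1) (s + 1))
    (B0 : ∀ t s, B t s → t < N → E (t + 1) s)
    (EG : ∀ t s, E t s → t < N → ¬ cp t → G (t + 1) s)
    (G1 : ∀ t s, G t s → t < N → ¬ cp t → G (t + 1) (s + 1))
    (gu : ∀ t s, E t s → t + 3 ≤ N → ¬ cp t → cp (t + 1) → ¬ cp (t + 2) → gd t → B (t + 3) (s + 2))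
    (db : ∀ t s, E t s → t + 5 ≤ N → ¬ cp t → cp (t + 1) → ¬ cp (t + 2) → cp (t + 3) → ¬ cp (t + 4) →
      ¬ gd t → ¬ gd (t + 2) → B (t + 5) (s + 3)) :
    ∀ k t s, N = t + k → E t s → ∃ s', B N s' ∧ (7 * s' - 4 * N : ℤ) ≥ 7 * s - 4 * t - 5 := by
  intro k
  induction k using Nat.strong_induction_on with
  | _ k ih =>
  intro t s hk hE
  have rec1 : ∀ t' s', t < t' → t' ≤ N → E t' s' → (7 * s' - 4 * t' : ℤ) ≥ 7 * s - 4 * t →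
      ∃ s', B N s' ∧ (7 * s' - 4 * N : ℤ) ≥ 7 * s - 4 * t - 5 := by
    intro t' s' h1 h2 h3 h4
    obtain ⟨s'', h5, h6⟩ := ih (N - t') (by omega) t' s' (by omega) h3
    exact ⟨s'', h5, by omega⟩
  have rec2 : ∀ t' s', t < t' → t' ≤ N → G t' s' → (7 * s' - 4 * t' : ℤ) ≥ 7 * s - 4 * t - 3 →
      ∃ s', B N s' ∧ (7 * s' - 4 * N : ℤ) ≥ 7 * s - 4 * t - 5 := by
    intro t' s' h1 h2 h3 h4
    rcases grun GB B1 G1 (N - t') t' s' (by omega) h3 with ⟨s'', h5, h6⟩ | ⟨t'', s'', h5, h6, h7, h8⟩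
    · exact ⟨s'', h5, by omega⟩
    · exact rec1 t'' s'' (by omega) h6 h7 (by omega)
  have fin : ∀ t' s', t' = N → B t' s' → (7 * s' - 4 * t' : ℤ) ≥ 7 * s - 4 * t - 5 →
      ∃ s', B N s' ∧ (7 * s' - 4 * N : ℤ) ≥ 7 * s - 4 * t - 5 := by
    intro t' s' h1 h2 h3; subst h1; exact ⟨s', h2, h3⟩
  by_cases e0 : t = N
  · exact fin t s e0 (EB _ _ hE) (by omega)
  by_cases c0 : cp t
  · exact rec1 _ _ (by omega) (by omega) (B1 _ _ (EB _ _ hE) (by omega) c0) (by push_cast; omega)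
  have E1 := B0 _ _ (EB _ _ hE) (by omega)
  by_cases e1 : t + 1 = N
  · exact fin _ _ e1 (EB _ _ E1) (by push_cast; omega)
  by_cases c1 : cp (t + 1)
  swap
  · exact rec2 _ _ (by omega) (by omega) (G1 _ _ (EG _ _ hE (by omega) c0) (by omega) c1) (by push_cast; omega)
  have E2 := B1 _ _ (EB _ _ E1) (by omega) c1
  by_cases e2 : t + 2 = N
  · exact fin _ _ e2 (EB _ _ E2) (by push_cast; omega)
  by_cases c2 : cp (t + 2)
  · exact rec1 _ _ (by omega) (by omega) (B1 _ _ (EB _ _ E2) (by omega) c2) (by push_cast; omega)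
  have E3 := B0 _ _ (EB _ _ E2) (by omega)
  by_cases e3 : t + 3 = N
  · exact fin _ _ e3 (EB _ _ E3) (by push_cast; omega)
  by_cases c3 : cp (t + 3)
  swap
  · exact rec2 _ _ (by omega) (by omega) (G1 _ _ (EG _ _ E2 (by omega) c2) (by omega) c3) (by push_cast; omega)
  by_cases g0 : gd t
  · exact rec1 _ _ (by omega) (by omega) (B1 _ _ (gu _ _ hE (by omega) c0 c1 c2 g0) (by omega) c3) (by push_cast; omega)
  have E4 := B1 _ _ (EB _ _ E3) (by omega) c3
  by_cases e4 : t + 4 = N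
  · exact fin _ _ e4 (EB _ _ E4) (by push_cast; omega)
  by_cases c4 : cp (t + 4)
  · exact rec1 _ _ (by omega) (by omega) (B1 _ _ (EB _ _ E4) (by omega) c4) (by push_cast; omega)
  have B5 : B (t + 5) (s + 3) := by
    by_cases g2 : gd (t + 2)
    · exact gu _ _ E2 (by omega) c2 c3 c4 g2
    · exact db _ _ hE (by omega) c0 c1 c2 c3 c4 g0 g2
  by_cases e5 : t + 5 = N
  · exact fin _ _ e5 B5 (by push_cast; omega)
  by_cases c5 : cp (t + 5)
  · exact rec1 _ _ (by omega) (by omega) (B1 _ _ B5 (by omega) c5) (by push_cast; omega)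
  · exact rec2 _ _ (by omega) (by omega) (G1 _ _ (EG _ _ E4 (by omega) c4) (by omega) c5) (by push_cast; omega)

end comb

theorem EE_start {O P p N} (c : Cfg O P p N) : EE O P p 0 0 := by
  have o := c.ord 0 1 (by omega) (by omega)
  have h0 : SPart O P [p 0] [] := by
    refine ⟨List.pairwise_singleton _ _, ?_, by simp, by simp, by simp [reg_one]⟩
    intro x hx; rw [List.mem_singleton.1 hx]; exact c.mem 0 (by omega)
  refine ⟨[], TT O (p 0) (p 1), ⟨[], h0.append c.tr c.hO (c.mem 1 (by omega)) o, by simp, ?_⟩, FInv.tri o⟩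
  rintro x (rfl | ⟨i, hi, rfl⟩)
  · exact ⟨TT x (p 0) (p 1), by simp, mem_TT.2 (Or.inl rfl)⟩
  · refine ⟨TT O (p 0) (p 1), by simp, mem_TT.2 ?_⟩
    have : i = 0 ∨ i = 1 := by omega
    rcases this with rfl | rfl <;> tauto

theorem reach {O P p N} (c : Cfg O P p N) : ∃ s', BB O P p N s' ∧ (7 * s' - 4 * N : ℤ) ≥ - 5 := by
  obtain ⟨s', h1, h2⟩ := comb (E := EE O P p) (B := BB O P p) (G := GG O P p) (cp := cap p) (gd := gud p) (N := N)
    (fun _ _ h => EB h) (fun _ _ h => GB h) (fun _ _ h ht hc => TB1 c h ht hc) (fun _ _ h ht => TB0 c h ht)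
    (fun _ _ h ht hc => TEG c h ht hc) (fun _ _ h ht hc => TGG c h ht hc)
    (fun _ _ h ht h0 h1 h2 hg => TGood c h ht h0 h1 h2 hg)
    (fun _ _ h ht h0 h1 h2 h3 h4 hg hg' => TDbl c h ht h0 h1 h2 h3 h4 hg hg') N 0 0 (by omega) (EE_start c)
  exact ⟨s', h1, by simpa using h2⟩


theorem ear {O P} (hO : O ∈ P) : ∀ (k : ℕ) (C : List Pt) (L : List (Finset Pt)), C.length = k → SPart O P C L →
    ∃ C' L', SPart O P C' L' ∧ L'.length + C'.length = L.length + C.length ∧ (∀ f ∈ L, f ∈ L') ∧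
      ∀ Y c b a Z, C' = Y ++ c :: b :: a :: Z → ¬ cross a b c < 0 := by
  intro k
  induction k with
  | zero =>
    intro C L hk h
    refine ⟨C, L, h, rfl, fun f hf => hf, ?_⟩
    rintro Y c b a Z rfl
    simp at hk
  | succ k ih =>
    intro C L hk h
    by_cases hc : ∀ Y c b a Z, C = Y ++ c :: b :: a :: Z → ¬ cross a b c < 0
    · exact ⟨C, L, h, rfl, fun f hf => hf, hc⟩
    · push Not at hc
      obtain ⟨Y, c, b, a, Z, rfl, hneg⟩ := hc
      have h' := h.cut hO hneg
      obtain ⟨C', L', h1, h2, h3, h4⟩ := ih _ _ (by simp at hk ⊢; omega) h'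
      refine ⟨C', L', h1, ?_, fun f hf => h3 f (by simp [hf]), h4⟩
      rw [h2]; simp; omega

theorem reg_hull {O P} (hgp : GenPos P) (hT : AngTr O P) (hO : O ∈ P) : ∀ (Z : List Pt) (r q : Pt), Srt O (r :: q :: Z) →
    (∀ x ∈ r :: q :: Z, x ∈ P) →
    (∀ Y c b a Z', r :: q :: Z = Y ++ c :: b :: a :: Z' → ¬ cross a b c < 0) →
    ∃ F : Finset Pt, F ⊆ P ∧ HH F = Reg O (r :: q :: Z) ∧ FInv O F q r := by
  intro Z
  induction Z with
  | nil =>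
    intro r q hs hP _
    have hqr : 0 < cross O q r := (List.pairwise_cons.1 hs).1 q (by simp)
    refine ⟨TT O q r, ?_, by rw [reg_cons, reg_one, union_empty], FInv.tri hqr⟩
    intro x hx
    rcases mem_TT.1 hx with rfl | rfl | rfl
    · exact hO
    · exact hP _ (by simp)
    · exact hP _ (by simp)
  | cons e Z ih =>
    intro y r hs hP hc
    obtain ⟨F, f1, f2, f3⟩ := ih r e (List.pairwise_cons.1 hs).2 (fun x hx => hP x (by simp at hx ⊢; tauto))
      (fun Y c b a Z' h => hc (y :: Y) c b a Z' (by rw [h]; rfl))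
    have hry : 0 < cross O r y := (List.pairwise_cons.1 hs).1 r (by simp)
    have hey : 0 < cross O e y := (List.pairwise_cons.1 hs).1 e (by simp)
    have hcap : 0 < cross e r y := by
      have h1 := hc [] y r e Z rfl
      have h2 := hgp e (hP e (by simp)) r (hP r (by simp)) y (hP y (by simp)) (ne_of_cross f3.qr).2.1
        (ne_of_cross hry).2.1 (ne_of_cross hey).2.1
      exact lt_of_le_of_ne (not_lt.1 h1) h2.symm
    obtain ⟨m1, m2⟩ := finv_mc hT f1 f3 (hP e (by simp)) (hP y (by simp)) hry hcap
    refine ⟨F ∪ TT O r y, ?_, ?_, m2⟩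
    · refine Finset.union_subset f1 ?_
      intro x hx
      rcases mem_TT.1 hx with rfl | rfl | rfl
      · exact hO
      · exact hP _ (by simp)
      · exact hP _ (by simp)
    · rw [reg_cons, HH, m1.hull, union_comm, ← f2]

theorem ext_not_int {S : Set Pt} {x : Pt} (hx : x ∈ Set.extremePoints ℝ S) : x ∉ interior S := by
  intro hi
  rw [mem_extremePoints_iff_left] at hx
  let n : Pt := (1, 0)
  have hc : Continuous (fun e : ℝ => x - e • n) := by fun_prop
  have h0 : (fun e : ℝ => x - e • n) ⁻¹' (interior S) ∈ nhds (0:ℝ) := by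
    apply hc.continuousAt.preimage_mem_nhds
    simp only [zero_smul, sub_zero]
    exact isOpen_interior.mem_nhds hi
  rw [Metric.mem_nhds_iff] at h0
  obtain ⟨ε, hε, hb⟩ := h0
  have hm : (ε/2) ∈ Metric.ball (0:ℝ) ε := by
    rw [Metric.mem_ball, Real.dist_eq, sub_zero, abs_of_pos (by positivity)]; linarith
  have hm' : (-(ε/2)) ∈ Metric.ball (0:ℝ) ε := by
    rw [Metric.mem_ball, Real.dist_eq, sub_zero, abs_neg, abs_of_pos (by positivity)]; linarith
  have := hx.2 _ (interior_subset (hb hm)) _ (interior_subset (hb hm')) ⟨1/2, 1/2, by norm_num, by norm_num, by norm_num, by module⟩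
  have h1 := congrArg Prod.fst this
  simp [n] at h1
  linarith

theorem sort_list {O : Pt} {P : Finset Pt} (hT : AngTr O P) (S : Finset Pt) : S ⊆ P →
    (∀ x ∈ S, ∀ y ∈ S, x ≠ y → 0 < cross O x y ∨ 0 < cross O y x) →
    ∃ l : List Pt, l.Pairwise (fun x y => 0 < cross O x y) ∧ ∀ x, x ∈ l ↔ x ∈ S := by
  induction S using Finset.induction_on with
  | empty => intro _ _; exact ⟨[], by simp, by simp⟩
  | insert x S hx ih =>
    intro hP htot
    obtain ⟨l, h1, h2⟩ := ih (fun y hy => hP (Finset.mem_insert_of_mem hy))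
      (fun a ha b hb => htot a (Finset.mem_insert_of_mem ha) b (Finset.mem_insert_of_mem hb))
    have hl : ∀ y ∈ l, y ∈ P := fun y hy => hP (Finset.mem_insert_of_mem ((h2 y).1 hy))
    have hxP : x ∈ P := hP (Finset.mem_insert_self _ _)
    refine ⟨l.filter (fun y => 0 < cross O y x) ++ x :: l.filter (fun y => 0 < cross O x y), ?_, ?_⟩
    · rw [List.pairwise_append]
      refine ⟨List.Pairwise.sublist List.filter_sublist h1, ?_, ?_⟩
      · rw [List.pairwise_cons]
        refine ⟨?_, List.Pairwise.sublist List.filter_sublist h1⟩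
        intro y hy
        simpa using (List.mem_filter.1 hy).2
      · intro y hy z hz
        have hy1 := (List.mem_filter.1 hy).1
        have hy2 : 0 < cross O y x := by simpa using (List.mem_filter.1 hy).2
        rcases List.mem_cons.1 hz with rfl | hz
        · exact hy2
        · have hz1 := (List.mem_filter.1 hz).1
          have hz2 : 0 < cross O x z := by simpa using (List.mem_filter.1 hz).2
          exact hT y (hl y hy1) x hxP z (hl z hz1) hy2 hz2
    · intro y
      simp only [List.mem_append, List.mem_filter, List.mem_cons, decide_eq_true_eq, Finset.mem_insert, h2]
      constructor
      · tauto
      · rintro (rfl | hy)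
        · tauto
        · have hne : y ≠ x := by rintro rfl; exact hx hy
          have := htot y (Finset.mem_insert_of_mem hy) x (Finset.mem_insert_self _ _) hne
          tauto

theorem exists_O {P : Finset Pt} (h : P.Nonempty) : ∃ O ∈ P, AngTr O P := by
  obtain ⟨O, hO, hmin⟩ := Finset.exists_min_image P (fun x => toLex x) h
  refine ⟨O, hO, ?_⟩
  have hm : ∀ x ∈ P, O.1 ≤ x.1 ∧ (O.1 = x.1 → O.2 ≤ x.2) := by
    intro x hx
    have := hmin x hx
    rw [Prod.Lex.toLex_le_toLex] at this
    rcases this with h | ⟨h, h'⟩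
    · exact ⟨h.le, fun e => absurd e h.ne⟩
    · exact ⟨h.le, fun _ => h'⟩
  intro x hx y hy z hz h1 h2
  obtain ⟨a1, a2⟩ := hm x hx
  obtain ⟨b1, b2⟩ := hm y hy
  obtain ⟨c1, c2⟩ := hm z hz
  have id1 : (y.1 - O.1) * cross O x z = (x.1 - O.1) * cross O y z + (z.1 - O.1) * cross O x y := by
    simp only [cross]; ring
  have p1 : 0 ≤ (x.1 - O.1) * cross O y z := mul_nonneg (by linarith) h2.le
  have p2 : 0 ≤ (z.1 - O.1) * cross O x y := mul_nonneg (by linarith) h1.le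
  rcases eq_or_lt_of_le a1 with ea | ea
  · have a2' := a2 ea
    rcases eq_or_lt_of_le c1 with ec | ec
    · exfalso
      have e : cross O x y = - ((x.2 - O.2) * (y.1 - O.1)) := by simp only [cross]; rw [ea]; ring
      have : 0 ≤ (x.2 - O.2) * (y.1 - O.1) := mul_nonneg (by linarith) (by linarith)
      linarith
    · have : 0 < (z.1 - O.1) * cross O x y := mul_pos (by linarith) h1
      exact pos_of_mul_pos_right (by linarith : 0 < (y.1 - O.1) * cross O x z) (by linarith)
  · have : 0 < (x.1 - O.1) * cross O y z := mul_pos (by linarith) h2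
    exact pos_of_mul_pos_right (by linarith : 0 < (y.1 - O.1) * cross O x z) (by linarith)

theorem exists_cfg {P : Finset Pt} (h3 : 3 ≤ P.card) (hgp : GenPos P) :
    ∃ O p N, Cfg O P p N ∧ P.card = N + 3 ∧ ∀ x ∈ P, x ∈ DD O p N := by
  obtain ⟨O, hO, hT⟩ := exists_O (P := P) (Finset.card_pos.1 (by omega))
  have htot : ∀ x ∈ P.erase O, ∀ y ∈ P.erase O, x ≠ y → 0 < cross O x y ∨ 0 < cross O y x := by
    intro x hx y hy hne
    rw [Finset.mem_erase] at hx hy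
    have := hgp O hO x hx.2 y hy.2 hx.1.symm hne hy.1.symm
    have e := c_neg O x y
    rcases lt_or_gt_of_ne this with h | h
    · right; linarith
    · left; exact h
  obtain ⟨l, h1, h2⟩ := sort_list hT (P.erase O) (Finset.erase_subset _ _) htot
  have hnd : l.Nodup := h1.imp (fun {a b} h => (ne_of_cross h).2.1)
  have hlen : l.length = P.card - 1 := by
    rw [← Finset.card_erase_of_mem hO, ← List.toFinset_card_of_nodup hnd]
    congr 1; ext x; rw [List.mem_toFinset, h2]
  have hget : ∀ i (hi : i < l.length), l.getD i O = l[i] := fun i hi => by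
    rw [List.getD_eq_getElem _ _ hi]
  refine ⟨O, fun i => l.getD i O, P.card - 3, ⟨hO, hgp, hT, ?_, ?_⟩, by omega, ?_⟩
  · intro i hi
    have hi' : i < l.length := by omega
    simp only [hget i hi']
    exact Finset.mem_of_mem_erase ((h2 _).1 (List.getElem_mem hi'))
  · intro i j hij hj
    have hi' : i < l.length := by omega
    have hj' : j < l.length := by omega
    simp only [hget i hi', hget j hj']
    exact List.pairwise_iff_getElem.1 h1 i j hi' hj' hij
  · intro x hx
    by_cases hxO : x = O
    · exact Or.inl hxO
    · right
      obtain ⟨i, hi, e⟩ := List.getElem_of_mem ((h2 x).2 (Finset.mem_erase.2 ⟨hxO, hx⟩))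
      exact ⟨i, by omega, by simp only [hget i hi]; exact e.symm⟩

theorem main17 (P : Finset Pt) (h3 : 3 ≤ P.card) (hgp : GenPos P) :
    ∃ U : Finset (Finset Pt), IsConvexPartition P U ∧
      (∀ x ∈ P, ∃ p ∈ U, x ∈ p) ∧
      (U.card : ℤ) ≤ ⌈(10 * (P.card : ℚ) - 18) / 7⌉ := by
  obtain ⟨O, p, N, c, hN, hD⟩ := exists_cfg h3 hgp
  obtain ⟨s, hB, hs⟩ := reach c
  obtain ⟨Z, f, ⟨V, q1, q2, q3⟩, _⟩ := hB
  obtain ⟨C, L, k1, k2, k3, k4⟩ := ear c.hO _ _ _ rfl q1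
  have hcov : ∀ x ∈ P, ∃ f ∈ L, x ∈ f := by
    intro x hx
    obtain ⟨g, hg, hxg⟩ := q3 x (hD x hx)
    exact ⟨g, k3 g hg, hxg⟩
  have hreg : ∀ x ∈ P, x ∈ Reg O C := by
    intro x hx
    obtain ⟨g, hg, hxg⟩ := hcov x hx
    exact (k1.cov x).1 ⟨g, hg, subset_convexHull ℝ _ hxg⟩
  have hC : ∃ r q Z', C = r :: q :: Z' := by
    have := hreg O c.hO
    match C, this with
    | [], h => simp [Reg] at h
    | [a], h => simp [Reg] at h
    | r :: q :: Z', _ => exact ⟨r, q, Z', rfl⟩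
  obtain ⟨r, q, Z', rfl⟩ := hC
  obtain ⟨F, f1, f2, _⟩ := reg_hull hgp c.tr c.hO Z' r q k1.srt k1.sub k4
  have hconv : Reg O (r :: q :: Z') = convexHull ℝ (P : Set Pt) := by
    apply subset_antisymm
    · rw [← f2]; exact convexHull_mono (Finset.coe_subset.2 f1)
    · apply convexHull_min
      · intro x hx; exact hreg x hx
      · rw [← f2]; exact convex_convexHull ℝ _
  have hdis : ∀ f ∈ L, ∀ g ∈ L, f ≠ g → Disjoint (interior (HH f)) (interior (HH g)) := by
    intro f hf g hg hne
    haveI : Std.Symm (fun f g : Finset Pt => Disjoint (interior (HH f)) (interior (HH g))) := ⟨fun _ _ h => h.symm⟩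
    exact List.Pairwise.forall k1.disj hf hg hne
  refine ⟨L.toFinset, ⟨?_, ?_, ?_⟩, ?_, ?_⟩
  · intro g hg
    rw [List.mem_toFinset] at hg
    have hF := k1.face g hg
    refine ⟨hF.sub, hF.card, hF.ext, ?_⟩
    intro x hx hxi
    obtain ⟨g', hg', hxg'⟩ := hcov x hx
    by_cases e : g' = g
    · subst e; exact ext_not_int (hF.ext x hxg') hxi
    · have := disj_closure (convex_convexHull ℝ _) (k1.face g' hg').int (hdis g' hg' g hg e)
      exact Set.disjoint_left.1 this (subset_convexHull ℝ _ hxg') hxi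
  · intro a ha b hb hne
    rw [List.mem_toFinset] at ha hb
    exact Set.disjoint_iff_inter_eq_empty.1 (hdis a ha b hb hne)
  · rw [← hconv]
    ext z
    rw [← k1.cov z]
    simp
  · intro x hx
    obtain ⟨g, hg, hxg⟩ := hcov x hx
    exact ⟨g, List.mem_toFinset.2 hg, hxg⟩
  · have hcard := List.toFinset_card_le L
    simp only [List.length_cons, List.length_append] at k2 q2
    have h7 : (7 * (L.toFinset.card : ℤ)) ≤ 10 * P.card - 18 := by omega
    rw [← Int.cast_le (R := ℚ)]
    refine le_trans ?_ (Int.le_ceil _)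
    rw [le_div_iff₀ (by norm_num)]
    have : ((7 * (L.toFinset.card : ℤ) : ℤ) : ℚ) ≤ ((10 * P.card - 18 : ℤ) : ℚ) := by exact_mod_cast h7
    push_cast at this ⊢
    linarith


/-- every set of n ≥ 3 points in general position admits a convex
partition, using every point as a vertex, with at most ⌈(10n-18)/7⌉ faces. -/
theorem stmt_17 (P : Finset Pt) (h3 : 3 ≤ P.card) (hgp : GenPos P) :
    ∃ U : Finset (Finset Pt), IsConvexPartition P U ∧
      (∀ x ∈ P, ∃ p ∈ U, x ∈ p) ∧
      (U.card : ℤ) ≤ ⌈(10 * (P.card : ℚ) - 18) / 7⌉ := by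
  exact main17 P h3 hgp
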